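/- arXiv:2305.12465 — 2 statements merged into one kernel-verified Lean document; each statement's English description precedes it below -/
import Mathlib

section
/- Let H be a Hopf algebra with invertible antipode and B a braided-commutative right-right H-crossed module algebra. Then Z¹_◁(H,B) is a group under the product (ϱ • ϱ')(h) := ϱ(h₍₁₎) ψ(ϱ'(h₍₂₎)), where ψ(b) := b₍₀₎ ϱ(b₍₁₎), with inverse ϱ⁻¹(h) = ψ⁻¹(ϱ(Sh₍₁₎) ◁ h₍₂₎). Moreover, for each ϱ ∈ Z¹_◁(H,B) the map ψ is an algebra automorphism of B, and ϱ ↦ ψ is a group homomorphism Z¹_◁(H,B) → Aut(B). -/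
open scoped TensorProduct
open TensorProduct

noncomputable section
attribute [local instance] Classical.propDecidable

/-- Choice-based lift of a (bilinear) function to the tensor product: if a linear map agreeing
with `f` on pure tensors exists, this is it (it is then unique); otherwise `0`. -/
def tlift (R : Type*) [CommRing R] {M N Q : Type*} [AddCommGroup M] [Module R M]
    [AddCommGroup N] [Module R N] [AddCommGroup Q] [Module R Q]
    (f : M → N → Q) : M ⊗[R] N →ₗ[R] Q :=
  if h : ∃ F : M ⊗[R] N →ₗ[R] Q, ∀ x y, F (x ⊗ₜ[R] y) = f x y then h.choose else 0

/-- Choice-based lift of a (bilinear, balanced) function to a quotient of the tensor product. -/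
def qtlift (R : Type*) [CommRing R] {M N Q : Type*} [AddCommGroup M] [Module R M]
    [AddCommGroup N] [Module R N] [AddCommGroup Q] [Module R Q]
    (p : Submodule R (M ⊗[R] N)) (f : M → N → Q) : ((M ⊗[R] N) ⧸ p) →ₗ[R] Q :=
  if h : ∃ F : ((M ⊗[R] N) ⧸ p) →ₗ[R] Q,
      ∀ x y, F (Submodule.Quotient.mk (x ⊗ₜ[R] y)) = f x y then h.choose else 0

variable (k : Type*) [Field k]

/-- Source and target data for a left bialgebroid over `B`: an algebra map `s : B → L` and an
anti-algebra map `t : B → L` with commuting ranges. -/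
structure BgdST (B L : Type*) [Ring B] [Algebra k B] [Ring L] [Algebra k L] where
  s : B →ₐ[k] L
  t : B →ₗ[k] L
  t_one : t 1 = 1
  t_mul : ∀ a b : B, t (a * b) = t b * t a
  st_comm : ∀ a b : B, s a * t b = t b * s a

namespace BgdST

variable {k} {B L : Type*} [Ring B] [Algebra k B] [Ring L] [Algebra k L]
variable (st : BgdST k B L)

/-- The relations defining `L ⊗_B L`: `t a · X ⊗ Y  ~  X ⊗ s a · Y`. -/
def rel : Submodule k (L ⊗[k] L) :=
  Submodule.span k {z | ∃ (a : B) (X Y : L), z = (st.t a * X) ⊗ₜ[k] Y - X ⊗ₜ[k] (st.s a * Y)}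

/-- `L ⊗_B L` (the coring tensor square). -/
abbrev T2 := (L ⊗[k] L) ⧸ st.rel

/-- Class of a pure tensor in `L ⊗_B L`. -/
def mk2 (X Y : L) : st.T2 := Submodule.Quotient.mk (X ⊗ₜ[k] Y)

/-- Evaluate a balanced bilinear expression on an element of `L ⊗_B L`. -/
def lift2 {Q : Type*} [AddCommGroup Q] [Module k Q] (f : L → L → Q) : st.T2 →ₗ[k] Q :=
  qtlift k st.rel f

/-- The relations defining `L ⊗_{B^{op}} L`: `X·t a ⊗ Y ~ X ⊗ t a · Y`. -/
def relOp : Submodule k (L ⊗[k] L) :=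
  Submodule.span k {z | ∃ (a : B) (X Y : L), z = (X * st.t a) ⊗ₜ[k] Y - X ⊗ₜ[k] (st.t a * Y)}

/-- `L ⊗_{B^{op}} L` (domain of the canonical map `λ`). -/
abbrev TOp := (L ⊗[k] L) ⧸ st.relOp

def mkOp (X Y : L) : st.TOp := Submodule.Quotient.mk (X ⊗ₜ[k] Y)

def liftOp {Q : Type*} [AddCommGroup Q] [Module k Q] (f : L → L → Q) : st.TOp →ₗ[k] Q :=
  qtlift k st.relOp f

/-- The relations defining `L ⊗^{B^{op}} L`: `s a · X ⊗ Y ~ X ⊗ Y · s a`. -/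
def relA : Submodule k (L ⊗[k] L) :=
  Submodule.span k {z | ∃ (a : B) (X Y : L), z = (st.s a * X) ⊗ₜ[k] Y - X ⊗ₜ[k] (Y * st.s a)}

/-- `L ⊗^{B^{op}} L` (domain of the canonical map `μ`). -/
abbrev TA := (L ⊗[k] L) ⧸ st.relA

def mkA (X Y : L) : st.TA := Submodule.Quotient.mk (X ⊗ₜ[k] Y)

def liftA {Q : Type*} [AddCommGroup Q] [Module k Q] (f : L → L → Q) : st.TA →ₗ[k] Q :=
  qtlift k st.relA f

/-- Relations for the triple tensor `L ⊗_B L ⊗_B L`. -/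
def rel3 : Submodule k (L ⊗[k] (L ⊗[k] L)) :=
  Submodule.span k
    ({z | ∃ (a : B) (X Y Z : L),
        z = (st.t a * X) ⊗ₜ[k] (Y ⊗ₜ[k] Z) - X ⊗ₜ[k] ((st.s a * Y) ⊗ₜ[k] Z)} ∪
     {z | ∃ (a : B) (X Y Z : L),
        z = X ⊗ₜ[k] ((st.t a * Y) ⊗ₜ[k] Z) - X ⊗ₜ[k] (Y ⊗ₜ[k] (st.s a * Z))})

/-- `L ⊗_B L ⊗_B L`. -/
abbrev T3 := (L ⊗[k] (L ⊗[k] L)) ⧸ st.rel3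

def mk3 (X Y Z : L) : st.T3 := Submodule.Quotient.mk (X ⊗ₜ[k] (Y ⊗ₜ[k] Z))

/-- The factorwise product of two elements of `L ⊗_B L`, whenever it is well defined
on representatives (as it is when the left factor lies in the Takeuchi product);
junk value `0` otherwise. -/
def mulT2 (z w : st.T2) : st.T2 :=
  if h : ∃ u : st.T2, ∀ zr wr : L ⊗[k] L, Submodule.Quotient.mk zr = z →
      Submodule.Quotient.mk wr = w → Submodule.Quotient.mk (zr * wr) = u
  then h.choose else 0

variable (cop : L →ₗ[k] st.T2) (cou : L →ₗ[k] B)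

/-- The axioms of a left bialgebroid over `B` with structure `(s,t,Δ,ε) = (st.s, st.t, cop, cou)`
(Definition 2.3 of the paper): `L` is a `B^e`-ring and a `B`-coring, the coproduct corestricts
to an algebra map into the Takeuchi product, and the counit is a left character. -/
structure IsLeftBialgebroid : Prop where
  comul_one : cop 1 = st.mk2 1 1
  comul_mul : ∀ X Y : L, cop (X * Y) = st.mulT2 (cop X) (cop Y)
  comul_s : ∀ (b : B) (X : L),
    cop (st.s b * X) = st.lift2 (fun x y => st.mk2 (st.s b * x) y) (cop X)
  comul_t : ∀ (b : B) (X : L),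
    cop (st.t b * X) = st.lift2 (fun x y => st.mk2 x (st.t b * y)) (cop X)
  takeuchi : ∀ (b : B) (X : L),
    st.lift2 (fun x y => st.mk2 (x * st.t b) y) (cop X) =
      st.lift2 (fun x y => st.mk2 x (y * st.s b)) (cop X)
  coassoc : ∀ X : L,
    st.lift2 (fun x1 x2 => st.lift2 (fun y1 y2 => st.mk3 x1 y1 y2) (cop x2)) (cop X) =
      st.lift2 (fun x12 x3 => st.lift2 (fun x1 x2 => st.mk3 x1 x2 x3) (cop x12)) (cop X)
  counit_comul_left : ∀ X : L, st.lift2 (fun x1 x2 => st.s (cou x1) * x2) (cop X) = X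
  counit_comul_right : ∀ X : L, st.lift2 (fun x1 x2 => st.t (cou x2) * x1) (cop X) = X
  counit_one : cou 1 = 1
  counit_s : ∀ (b : B) (X : L), cou (st.s b * X) = b * cou X
  counit_t : ∀ (b : B) (X : L), cou (st.t b * X) = cou X * b
  counit_char_s : ∀ X Y : L, cou (X * st.s (cou Y)) = cou (X * Y)
  counit_char_t : ∀ X Y : L, cou (X * st.t (cou Y)) = cou (X * Y)

/-- The canonical map `λ : L ⊗_{B^{op}} L → L ⊗_B L`, `X ⊗ Y ↦ X₍₁₎ ⊗ X₍₂₎Y`. -/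
def lam : st.TOp →ₗ[k] st.T2 :=
  st.liftOp (fun X Y => st.lift2 (fun x1 x2 => st.mk2 x1 (x2 * Y)) (cop X))

/-- A left bialgebroid is a left Hopf algebroid if `λ` is bijective. -/
def IsLeftHopf : Prop := Function.Bijective (st.lam cop)

/-- The canonical map `μ : L ⊗^{B^{op}} L → L ⊗_B L`, `X ⊗ Y ↦ Y₍₁₎X ⊗ Y₍₂₎`. -/
def mu : st.TA →ₗ[k] st.T2 :=
  st.liftA (fun X Y => st.lift2 (fun y1 y2 => st.mk2 (y1 * X) y2) (cop Y))

/-- A left bialgebroid is an anti-left Hopf algebroid if `μ` is bijective. -/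
def IsAntiLeftHopf : Prop := Function.Bijective (st.mu cop)

/-- `X₊ ⊗_{B^{op}} X₋ := λ⁻¹(X ⊗_B 1)` (meaningful when `λ` is bijective). -/
def plusMinus (X : L) : st.TOp := Function.invFun (st.lam cop) (st.mk2 X 1)

/-- `X₍₋₎ ⊗^{B^{op}} X₍₊₎ := μ⁻¹(1 ⊗_B X)` (meaningful when `μ` is bijective). -/
def minusPlus (X : L) : st.TA := Function.invFun (st.mu cop) (st.mk2 1 X)

/-- A left bisection of a left bialgebroid (Definition 3.1). -/
structure IsLeftBisection (σ : L →ₗ[k] B) : Prop where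
  unital : σ 1 = 1
  t_prop : ∀ (b : B) (X : L), σ (st.t b * X) = σ X * b
  s_mul : ∀ a b : B, σ (st.s (a * b)) = σ (st.s a) * σ (st.s b)
  s_bij : Function.Bijective (fun b => σ (st.s b))
  prod_t : ∀ X Y : L, σ (X * Y) = σ (X * st.t (σ Y))
  prod_s : ∀ X Y : L,
    σ (X * Y) = σ (X * st.s (Function.invFun (fun b => σ (st.s b)) (σ Y)))

/-- Convolution of left bisections:  `(σ * η)(X) := σ(s(η(X₍₁₎)) X₍₂₎)`. -/
def bconv (σ η : L →ₗ[k] B) : L →ₗ[k] B :=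
  (st.lift2 (fun x1 x2 => σ (st.s (η x1) * x2))).comp cop

/-- A right bisection of a left bialgebroid (Definition 3.6). -/
structure IsRightBisection (σ : L →ₗ[k] B) : Prop where
  unital : σ 1 = 1
  s_prop : ∀ (b : B) (X : L), σ (st.s b * X) = b * σ X
  t_mul : ∀ a b : B, σ (st.t (a * b)) = σ (st.t b) * σ (st.t a)
  t_bij : Function.Bijective (fun b => σ (st.t b))
  prod_s : ∀ X Y : L, σ (X * Y) = σ (X * st.s (σ Y))
  prod_t : ∀ X Y : L,
    σ (X * Y) = σ (X * st.t (Function.invFun (fun b => σ (st.t b)) (σ Y)))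

/-- Convolution of right bisections:  `(σ • η)(X) := σ(t(η(X₍₂₎)) X₍₁₎)`. -/
def rconv (σ η : L →ₗ[k] B) : L →ₗ[k] B :=
  (st.lift2 (fun x1 x2 => σ (st.t (η x2) * x1))).comp cop

/-- An automorphism `(Φ, φ)` of a left bialgebroid. -/
structure IsBgdAut (Φ : L →ₐ[k] L) (φ : B →ₐ[k] B) : Prop where
  bijL : Function.Bijective Φ
  bijB : Function.Bijective φ
  comp_s : ∀ b : B, Φ (st.s b) = st.s (φ b)
  comp_t : ∀ b : B, Φ (st.t b) = st.t (φ b)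
  comp_comul : ∀ X : L,
    cop (Φ X) = st.lift2 (fun x1 x2 => st.mk2 (Φ x1) (Φ x2)) (cop X)
  comp_counit : ∀ X : L, cou (Φ X) = φ (cou X)

/-- `Ad^L_σ(X) := s(σ(X₍₁₎)) X₍₂₎₊ t(σ(X₍₂₎₋))`, for a left Hopf algebroid. -/
def adL (σ : L →ₗ[k] B) (X : L) : L :=
  st.lift2 (fun x1 x2 => st.s (σ x1) *
    st.liftOp (fun p m => p * st.t (σ m)) (st.plusMinus cop x2)) (cop X)

/-- `Ad^R_σ(X) := t(σ(X₍₂₎)) X₍₁₎₍₊₎ s(σ(X₍₁₎₍₋₎))`, for an anti-left Hopf algebroid. -/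
def adR (σ : L →ₗ[k] B) (X : L) : L :=
  st.lift2 (fun x1 x2 => st.t (σ x2) *
    st.liftA (fun m p => p * st.s (σ m)) (st.minusPlus cop x1)) (cop X)

/-- The `B`-bimodule-map conditions on a map `L → B` used for `C¹(L,B)`. -/
def IsBimodMap (U : L →ₗ[k] B) : Prop :=
  (∀ (b : B) (X : L), U (st.t b * X) = U X * b) ∧
  (∀ (b : B) (X : L), U (st.s b * X) = b * U X)

/-- Convolution `(U * V)(X) = U(X₍₁₎) V(X₍₂₎)` of `B`-valued maps. -/
def cconv (U V : L →ₗ[k] B) : L →ₗ[k] B :=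
  (st.lift2 (fun x1 x2 => U x1 * V x2)).comp cop

/-- Extended vertical bisections `C¹(L,B)`: unital convolution-invertible `B`-bimodule maps
`U : L → B` with `U(X s(b)) = U(X t(b))`. -/
def IsC1 (U : L →ₗ[k] B) : Prop :=
  U 1 = 1 ∧ st.IsBimodMap U ∧
  (∀ (b : B) (X : L), U (X * st.s b) = U (X * st.t b)) ∧
  ∃ V : L →ₗ[k] B, st.IsBimodMap V ∧ st.cconv cop U V = cou ∧ st.cconv cop V U = cou

/-- Convolution product on `B`-bimodule maps `L ⊗_{B^e} L → B`:
`(f ⋆ g)(X,Y) = f(X₍₁₎,Y₍₁₎) g(X₍₂₎,Y₍₂₎)`. -/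
def conv2 (f g : L → L → B) (X Y : L) : B :=
  st.lift2 (fun y1 y2 =>
    st.lift2 (fun x1 x2 => f x1 y1 * g x2 y2) (cop X)) (cop Y)

/-- The unit `ε̃(X ⊗ Y) = ε(XY)` of the convolution algebra. -/
def unit2 (X Y : L) : B := cou (X * Y)

/-- Left-hand side of the 2-cocycle condition: `Γ(X, s(Γ(Y₍₁₎,Z₍₁₎)) Y₍₂₎Z₍₂₎)`. -/
def cocL (Γ : L → L → B) (X Y Z : L) : B :=
  st.lift2 (fun z1 z2 =>
    st.lift2 (fun y1 y2 => Γ X (st.s (Γ y1 z1) * (y2 * z2))) (cop Y)) (cop Z)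

/-- Right-hand side of the 2-cocycle condition: `Γ(s(Γ(X₍₁₎,Y₍₁₎)) X₍₂₎Y₍₂₎, Z)`. -/
def cocR (Γ : L → L → B) (X Y Z : L) : B :=
  st.lift2 (fun y1 y2 =>
    st.lift2 (fun x1 x2 => Γ (st.s (Γ x1 y1) * (x2 * y2)) Z) (cop X)) (cop Y)

/-- Membership of a bilinear map in `_B Hom_B (L ⊗_{B^e} L, B)`. -/
def IsBihom (Γ : L → L → B) : Prop :=
  (∃ Γ' : L →ₗ[k] L →ₗ[k] B, ∀ X Y, Γ' X Y = Γ X Y) ∧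
  (∀ (b c : B) (X Y : L), Γ (st.s b * (st.t c * X)) Y = b * Γ X Y * c) ∧
  (∀ (b c : B) (X Y : L), Γ (X * st.s b * st.t c) Y = Γ X (st.s b * (st.t c * Y)))

/-- An invertible normalised 2-cocycle on a left bialgebroid (Definition 2.6);
the collection of these is `Z²(L,B)`. -/
structure IsZ2 (Γ : L → L → B) : Prop where
  bihom : st.IsBihom Γ
  norm_left : ∀ X : L, Γ 1 X = cou X
  norm_right : ∀ X : L, Γ X 1 = cou X
  st_indep : ∀ (b : B) (X Y : L), Γ X (Y * st.s b) = Γ X (Y * st.t b)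
  cocycle : ∀ X Y Z : L, st.cocL cop Γ X Y Z = st.cocR cop Γ X Y Z
  inv : ∃ Γi : L → L → B, st.IsBihom Γi ∧
    (∀ X Y, st.conv2 cop Γ Γi X Y = unit2 cou X Y) ∧
    (∀ X Y, st.conv2 cop Γi Γ X Y = unit2 cou X Y)

/-- The coboundary `∂U(X,Y) = U⁻¹(X₍₁₎ t(U⁻¹(Y₍₁₎))) U(X₍₂₎Y₍₂₎)` of `U ∈ C¹(L,B)`. -/
def coboundary (U Ui : L →ₗ[k] B) (X Y : L) : B :=
  st.lift2 (fun y1 y2 =>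
    st.lift2 (fun x1 x2 => Ui (x1 * st.t (Ui y1)) * U (x2 * y2)) (cop X)) (cop Y)

/-- The transform `Γ^U(X,Y) = U⁻¹(X₍₁₎ t(U⁻¹(Y₍₁₎))) Γ(X₍₂₎,Y₍₂₎) U(X₍₃₎Y₍₃₎)`. -/
def gammaU (Γ : L → L → B) (U Ui : L →ₗ[k] B) (X Y : L) : B :=
  st.lift2 (fun y1 y23 => st.lift2 (fun y2 y3 =>
    st.lift2 (fun x1 x23 => st.lift2 (fun x2 x3 =>
      Ui (x1 * st.t (Ui y1)) * Γ x2 y2 * U (x3 * y3)) (cop x23)) (cop X))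
    (cop y23)) (cop Y)

/-- The cotwisted product `X ·_Γ Y := s(Γ(X₍₁₎,Y₍₁₎)) t(Γ⁻¹(X₍₃₎,Y₍₃₎)) X₍₂₎Y₍₂₎`. -/
def prodG (Γ Γi : L → L → B) (X Y : L) : L :=
  st.lift2 (fun y1 y23 => st.lift2 (fun y2 y3 =>
    st.lift2 (fun x1 x23 => st.lift2 (fun x2 x3 =>
      st.s (Γ x1 y1) * (st.t (Γi x3 y3) * (x2 * y2))) (cop x23)) (cop X))
    (cop y23)) (cop Y)

/-- `Ad_U(X) := s(U(X₍₁₎)) t(U⁻¹(X₍₃₎)) X₍₂₎`. -/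
def adU (U Ui : L →ₗ[k] B) (X : L) : L :=
  st.lift2 (fun x1 x23 => st.lift2 (fun x2 x3 =>
    st.s (U x1) * (st.t (Ui x3) * x2)) (cop x23)) (cop X)

end BgdST

end

/-! ## Crossed (Drinfeld–Yetter) module algebras and action Hopf algebroids -/

noncomputable section
attribute [local instance] Classical.propDecidable

universe u v

open scoped TensorProduct
open TensorProduct

variable {k : Type u} [Field k] {H : Type v} [Ring H] [HopfAlgebra k H]
  {B : Type v} [Ring B] [Algebra k B]

/-- A right-right `H`-crossed (Drinfeld–Yetter) module algebra structure on `B`, given by a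
right action `act` and a right coaction `coact`. -/
def IsRRCrossed (act : B → H → B) (coact : B → B ⊗[k] H) : Prop :=
  (∃ act' : B →ₗ[k] H →ₗ[k] B, ∀ (b : B) (h : H), act' b h = act b h) ∧
  (∃ coact' : B →ₗ[k] B ⊗[k] H, ∀ b : B, coact' b = coact b) ∧
  (∀ b : B, act b 1 = b) ∧
  (∀ (b : B) (g h : H), act (act b g) h = act b (g * h)) ∧
  (∀ h : H, act 1 h = algebraMap k B (Coalgebra.counit (R := k) h)) ∧
  (∀ (a b : B) (h : H), act (a * b) h =
    tlift k (fun h1 h2 => act a h1 * act b h2) (Coalgebra.comul (R := k) h)) ∧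
  (coact 1 = 1) ∧
  (∀ a b : B, coact (a * b) = coact a * coact b) ∧
  (∀ b : B,
    tlift k (fun b0 b1 => (b0 ⊗ₜ[k] (Coalgebra.comul (R := k) b1) : B ⊗[k] (H ⊗[k] H)))
      (coact b) =
    tlift k (fun b0 b1 => tlift k (fun c0 c1 => (c0 ⊗ₜ[k] (c1 ⊗ₜ[k] b1) : B ⊗[k] (H ⊗[k] H)))
      (coact b0)) (coact b)) ∧
  (∀ b : B, tlift k (fun b0 b1 => (Coalgebra.counit (R := k) b1 : k) • b0) (coact b) = b) ∧
  -- the Drinfeld–Yetter compatibility  (a ◁ h₂)₀ ⊗ h₁(a ◁ h₂)₁ = (a₀ ◁ h₁) ⊗ a₁h₂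
  (∀ (a : B) (h : H),
    tlift k (fun h1 h2 => tlift k (fun c0 c1 => c0 ⊗ₜ[k] (h1 * c1)) (coact (act a h2)))
      (Coalgebra.comul (R := k) h) =
    tlift k (fun b0 b1 => tlift k (fun h1 h2 => act b0 h1 ⊗ₜ[k] (b1 * h2))
      (Coalgebra.comul (R := k) h)) (coact a))

/-- Braided commutativity `a b = b₀ (a ◁ b₁)`. -/
def IsBraidedComm (act : B → H → B) (coact : B → B ⊗[k] H) : Prop :=
  ∀ a b : B, a * b = tlift k (fun b0 b1 => b0 * act a b1) (coact b)

/-- The smash product multiplication `(a # h)(b # g) = a (b ◁ h₁) # g h₂` on `B ⊗ H`. -/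
def smashMul (act : B → H → B) (z w : B ⊗[k] H) : B ⊗[k] H :=
  tlift k (fun a h => tlift k (fun b g => tlift k (fun h1 h2 =>
    (a * act b h1) ⊗ₜ[k] (g * h2)) (Coalgebra.comul (R := k) h)) w) z

/-- `ψ(b) = b₀ ϱ(b₁)` for `ϱ : H → B`. -/
def psiFun (coact : B → B ⊗[k] H) (ϱ : H → B) (b : B) : B :=
  tlift k (fun b0 b1 => b0 * ϱ b1) (coact b)

/-- `Z¹_◁(H,B)`: unital maps `ϱ : H → B` with `ϱ(gh) = (ϱ(g) ◁ h₁) ϱ(h₂)` and `ψ` bijective. -/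
def IsZ1cross (act : B → H → B) (coact : B → B ⊗[k] H) (ϱ : H →ₗ[k] B) : Prop :=
  ϱ 1 = 1 ∧
  (∀ g h : H, ϱ (g * h) =
    tlift k (fun h1 h2 => act (ϱ g) h1 * ϱ h2) (Coalgebra.comul (R := k) h)) ∧
  Function.Bijective (psiFun coact (⇑ϱ))

/-- The group product `(ϱ • ϱ')(h) = ϱ(h₁) ψ(ϱ'(h₂))` on `Z¹_◁(H,B)`. -/
def bulletFun (coact : B → B ⊗[k] H) (ϱ ϱ' : H → B) (h : H) : B :=
  tlift k (fun h1 h2 => ϱ h1 * psiFun coact ϱ (ϱ' h2)) (Coalgebra.comul (R := k) h)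

/-- The unit `h ↦ ε(h)1`. -/
def unitBmap : H →ₗ[k] B :=
  (Algebra.linearMap k B).comp (Coalgebra.counit (R := k) (A := H))

/-- Convolution of linear maps `H → B`. -/
def convHB (f g : H →ₗ[k] B) : H →ₗ[k] B :=
  (tlift k (fun h1 h2 => f h1 * g h2)).comp (Coalgebra.comul (R := k) (A := H))

/-- Convolution of maps `H ⊗ H → B`. -/
def convBB (γ δ : H → H → B) (h g : H) : B :=
  tlift k (fun h1 h2 => tlift k (fun g1 g2 => γ h1 g1 * δ h2 g2)
    (Coalgebra.comul (R := k) g)) (Coalgebra.comul (R := k) h)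

/-- `Z²_{◁,as}(H,B)`: convolution-invertible 2-cocycles of associative type. -/
def IsZ2as (act : B → H → B) (γ : H → H → B) : Prop :=
  (∃ γ' : H →ₗ[k] H →ₗ[k] B, ∀ h g, γ' h g = γ h g) ∧
  (∀ h : H, γ h 1 = algebraMap k B (Coalgebra.counit (R := k) h) ∧
    γ 1 h = algebraMap k B (Coalgebra.counit (R := k) h)) ∧
  (∀ h g f : H,
    tlift k (fun h1 h2 => tlift k (fun g1 g2 => tlift k (fun f1 f2 =>
      act (γ g1 f1) h1 * γ h2 (f2 * g2)) (Coalgebra.comul (R := k) f))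
        (Coalgebra.comul (R := k) g)) (Coalgebra.comul (R := k) h) =
    tlift k (fun h1 h2 => tlift k (fun g1 g2 =>
      γ h1 g1 * γ (g2 * h2) f) (Coalgebra.comul (R := k) g)) (Coalgebra.comul (R := k) h)) ∧
  (∀ (h g : H) (b : B),
    tlift k (fun h1 h2 => tlift k (fun g1 g2 => γ h1 g1 * act b (g2 * h2))
      (Coalgebra.comul (R := k) g)) (Coalgebra.comul (R := k) h) =
    tlift k (fun h1 h2 => tlift k (fun g1 g2 => act b (g1 * h1) * γ h2 g2)
      (Coalgebra.comul (R := k) g)) (Coalgebra.comul (R := k) h)) ∧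
  (∃ γi : H → H → B, (∃ γi' : H →ₗ[k] H →ₗ[k] B, ∀ h g, γi' h g = γi h g) ∧
    (∀ h g : H, convBB (k := k) γ γi h g =
      algebraMap k B (Coalgebra.counit (R := k) h * Coalgebra.counit (R := k) g)) ∧
    (∀ h g : H, convBB (k := k) γi γ h g =
      algebraMap k B (Coalgebra.counit (R := k) h * Coalgebra.counit (R := k) g)))

/-- `Z²_◁(H,B)`: the subset of `Z²_{◁,as}(H,B)` satisfying the two extra conditions. -/
def IsZ2cross (act : B → H → B) (coact : B → B ⊗[k] H) (γ : H → H → B) : Prop :=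
  IsZ2as (k := k) act γ ∧
  (∀ (h g : H) (c : B),
    tlift k (fun h1 h2 => γ h1 g * act c h2) (Coalgebra.comul (R := k) h) =
    tlift k (fun c0 c1 => tlift k (fun h1 h2 => act c0 h1 * γ h2 (g * c1))
      (Coalgebra.comul (R := k) h)) (coact c)) ∧
  (∀ (h g : H) (c : B),
    tlift k (fun c0 c1 => c0 * γ (h * c1) g) (coact c) = γ h g * c)

/-- `C¹_{◁,ver}(H,B)`: unital convolution-invertible maps `ϱ : H → B` with
`b₀ ϱ(h b₁) = ϱ(h) b` and `ϱ(h₁)(b ◁ h₂) = (b ◁ h₁) ϱ(h₂)`. -/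
def IsC1ver (act : B → H → B) (coact : B → B ⊗[k] H) (ϱ : H →ₗ[k] B) : Prop :=
  ϱ 1 = 1 ∧
  (∀ (h : H) (b : B), tlift k (fun b0 b1 => b0 * ϱ (h * b1)) (coact b) = ϱ h * b) ∧
  (∀ (h : H) (b : B),
    tlift k (fun h1 h2 => ϱ h1 * act b h2) (Coalgebra.comul (R := k) h) =
    tlift k (fun h1 h2 => act b h1 * ϱ h2) (Coalgebra.comul (R := k) h)) ∧
  ∃ ϱi : H →ₗ[k] B, convHB ϱ ϱi = unitBmap ∧ convHB ϱi ϱ = unitBmap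

/-- `γ^ϱ(h,g) = ϱ⁻¹(h₁)(ϱ⁻¹(g₁) ◁ h₂) γ(h₃, g₂) ϱ(g₃ h₄)`. -/
def gamRho (act : B → H → B) (ϱ ϱi : H → B) (γ : H → H → B) (h g : H) : B :=
  tlift k (fun h1 h234 => tlift k (fun h2 h34 => tlift k (fun h3 h4 =>
    tlift k (fun g1 g23 => tlift k (fun g2 g3 =>
      ϱi h1 * act (ϱi g1) h2 * γ h3 g2 * ϱ (g3 * h4)) (Coalgebra.comul (R := k) g23))
      (Coalgebra.comul (R := k) g))
    (Coalgebra.comul (R := k) h34)) (Coalgebra.comul (R := k) h234))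
    (Coalgebra.comul (R := k) h)

/-- The value `Γ_γ(a # h, b # g) = a (b ◁ h₁) γ(h₂, g)` computed through `ψ`. -/
def gammaSmash {L0 : Type v} [AddCommGroup L0] [Module k L0]
    (act : B → H → B) (ψ : L0 ≃ₗ[k] B ⊗[k] H) (γ : H → H → B) (z w : L0) : B :=
  tlift k (fun a h => tlift k (fun b g => tlift k (fun h1 h2 =>
    a * act b h1 * γ h2 g) (Coalgebra.comul (R := k) h)) (ψ w)) (ψ z)

end

section ConvolutionCocycles

open Coalgebra WithConv HopfAlgebra

variable {k : Type*} [Field k]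

theorem tlift_eq {M N Q : Type*} [AddCommGroup M] [Module k M] [AddCommGroup N] [Module k N]
    [AddCommGroup Q] [Module k Q] {f : M → N → Q} (F : M ⊗[k] N →ₗ[k] Q)
    (hF : ∀ x y, F (x ⊗ₜ[k] y) = f x y) : tlift k f = F := by
  have h : ∃ F : M ⊗[k] N →ₗ[k] Q, ∀ x y, F (x ⊗ₜ[k] y) = f x y := ⟨F, hF⟩
  rw [tlift, dif_pos h]
  exact TensorProduct.ext' fun x y => (h.choose_spec x y).trans (hF x y).symm

section Convolution

variable {H A : Type*} [Ring H] [Ring A] [Algebra k A]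

theorem tlift_comul_eq_convMul [Bialgebra k H] (f g : H →ₗ[k] A) (h : H) :
    tlift k (fun x y => f x * g y) (comul (R := k) h) = (toConv f * toConv g) h := by
  rw [tlift_eq (LinearMap.mul' k A ∘ₗ TensorProduct.map f g) (by simp)]
  rfl

/-- The left translate `h ↦ f (x * h)` of a linear map `f`. -/
def leftTranslate [Bialgebra k H] (f : WithConv (H →ₗ[k] A)) (x : H) : WithConv (H →ₗ[k] A) :=
  toConv (f.ofConv ∘ₗ LinearMap.mulLeft k x)

@[simp]
theorem leftTranslate_apply [Bialgebra k H] (f : WithConv (H →ₗ[k] A)) (x h : H) :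
    leftTranslate f x h = f (x * h) := rfl

theorem leftTranslate_convMul [Bialgebra k H] (f g : WithConv (H →ₗ[k] A)) (x : H) :
    leftTranslate (f * g) x =
      ∑ i ∈ (ℛ k x).index, leftTranslate f ((ℛ k x).left i) * leftTranslate g ((ℛ k x).right i) := by
  ext h
  change (f * g) (x * h) = _
  rw [((ℛ k x).mul (ℛ k h)).convMul_apply, ofConv_sum, LinearMap.sum_apply, Repr.mul_index,
    Finset.sum_product]
  refine Finset.sum_congr rfl fun i _ => ?_
  rw [(ℛ k h).convMul_apply]
  simp

theorem lift_comp_comul_convMul [Bialgebra k H] (F : H →ₗ[k] H →ₗ[k] A) (g : WithConv (H →ₗ[k] A))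
    (h : H) :
    (toConv (TensorProduct.lift F ∘ₗ comul) * g) h =
      ∑ i ∈ (ℛ k h).index, (toConv (F ((ℛ k h).left i)) * g) ((ℛ k h).right i) := by
  have key := congrArg (LinearMap.mul' k A ∘ₗ TensorProduct.map (TensorProduct.lift F) g.ofConv ∘ₗ
    (TensorProduct.assoc k H H H).symm.toLinearMap) (sum_tmul_tmul_eq (ℛ k h)
      (fun i => ℛ k ((ℛ k h).left i)) (fun i => ℛ k ((ℛ k h).right i)))
  simp only [map_sum, LinearMap.comp_apply, LinearEquiv.coe_coe, TensorProduct.assoc_symm_tmul,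
    TensorProduct.map_tmul, TensorProduct.lift.tmul, LinearMap.mul'_apply] at key
  rw [(ℛ k h).convMul_apply]
  refine Eq.trans (Finset.sum_congr rfl fun i _ => ?_) (key.trans (Finset.sum_congr rfl fun i _ =>
    ((ℛ k ((ℛ k h).right i)).convMul_apply (toConv (F ((ℛ k h).left i))) g).symm))
  change TensorProduct.lift F (comul ((ℛ k h).left i)) * _ = _
  rw [← (ℛ k ((ℛ k h).left i)).eq, map_sum, Finset.sum_mul]
  rfl

theorem algHom_comp_antipode_convMul [HopfAlgebra k H] (F : H →ₐ[k] A) :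
    toConv (F.toLinearMap ∘ₗ antipode k) * toConv F.toLinearMap = 1 := by
  have := LinearMap.algHom_comp_convMul_distrib F (toConv (antipode k (A := H)))
    (toConv LinearMap.id)
  rw [LinearMap.antipode_mul_id] at this
  refine ofConv_injective (this.symm.trans ?_)
  ext h
  simp

theorem algHom_convMul_comp_antipode [HopfAlgebra k H] (F : H →ₐ[k] A) :
    toConv F.toLinearMap * toConv (F.toLinearMap ∘ₗ antipode k) = 1 := by
  have := LinearMap.algHom_comp_convMul_distrib F (toConv LinearMap.id)
    (toConv (antipode k (A := H)))
  rw [LinearMap.id_mul_antipode] at this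
  refine ofConv_injective (this.symm.trans ?_)
  ext h
  simp

/-- Postcomposition with an algebra homomorphism, on convolution algebras. -/
def convComp [Bialgebra k H] {A' : Type*} [Ring A'] [Algebra k A'] (F : A →ₐ[k] A')
    (f : WithConv (H →ₗ[k] A)) : WithConv (H →ₗ[k] A') :=
  toConv (F.toLinearMap ∘ₗ f.ofConv)

@[simp]
theorem convComp_apply [Bialgebra k H] {A' : Type*} [Ring A'] [Algebra k A'] (F : A →ₐ[k] A')
    (f : WithConv (H →ₗ[k] A)) (h : H) : convComp F f h = F (f h) := rfl

theorem convComp_convMul [Bialgebra k H] {A' : Type*} [Ring A'] [Algebra k A'] (F : A →ₐ[k] A')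
    (f g : WithConv (H →ₗ[k] A)) : convComp F (f * g) = convComp F f * convComp F g :=
  ofConv_injective (LinearMap.algHom_comp_convMul_distrib F f g)

theorem convComp_one [Bialgebra k H] {A' : Type*} [Ring A'] [Algebra k A'] (F : A →ₐ[k] A') :
    convComp F (1 : WithConv (H →ₗ[k] A)) = 1 := by
  ext h
  simp

theorem leftTranslate_convComp [Bialgebra k H] {A' : Type*} [Ring A'] [Algebra k A']
    (F : A →ₐ[k] A') (f : WithConv (H →ₗ[k] A)) (x : H) :
    leftTranslate (convComp F f) x = convComp F (leftTranslate f x) := rfl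

theorem convComp_injective [Bialgebra k H] {A' : Type*} [Ring A'] [Algebra k A'] {F : A →ₐ[k] A'}
    (hF : Function.Injective F) :
    Function.Injective (convComp F : WithConv (H →ₗ[k] A) → WithConv (H →ₗ[k] A')) := by
  intro f g hfg
  ext h
  exact hF congr($hfg h)

end Convolution

section Coaction

variable {H B : Type v} [Ring H] [HopfAlgebra k H] [Ring B] [Algebra k B]

/-- The linear map `b ↦ b₍₀₎ f(b₍₁₎)`. -/
def coactEval (κ : B →ₗ[k] B ⊗[k] H) (f : WithConv (H →ₗ[k] B)) : B →ₗ[k] B :=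
  LinearMap.mul' k B ∘ₗ LinearMap.lTensor B f.ofConv ∘ₗ κ

theorem coactEval_apply_of_eq_sum {κ : B →ₗ[k] B ⊗[k] H} {b : B} {S : Finset (B × H)}
    (hS : κ b = ∑ i ∈ S, i.1 ⊗ₜ[k] i.2) (f : WithConv (H →ₗ[k] B)) :
    coactEval κ f b = ∑ i ∈ S, i.1 * f i.2 := by
  simp [coactEval, hS]

theorem psiFun_eq_coactEval (κ : B →ₗ[k] B ⊗[k] H) (f : H →ₗ[k] B) :
    psiFun (⇑κ) (⇑f) = ⇑(coactEval κ (toConv f)) := by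
  ext b
  rw [psiFun, tlift_eq (LinearMap.mul' k B ∘ₗ LinearMap.lTensor B f) (by simp)]
  rfl

theorem bulletFun_eq_convMul (κ : B →ₗ[k] B ⊗[k] H) (f g : H →ₗ[k] B) :
    bulletFun (⇑κ) (⇑f) (⇑g) =
      ⇑(toConv f * toConv (coactEval κ (toConv f) ∘ₗ g) : WithConv (H →ₗ[k] B)).ofConv := by
  ext h
  rw [bulletFun, psiFun_eq_coactEval]
  exact tlift_comul_eq_convMul f (coactEval κ (toConv f) ∘ₗ g) h

/-- A braided-commutative right-right crossed module algebra, expressed through linear maps and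
the convolution product. -/
structure IsBraidedCrossed (α : B →ₗ[k] H →ₗ[k] B) (κ : B →ₗ[k] B ⊗[k] H) : Prop where
  act_one : ∀ b, α b 1 = b
  act_act : ∀ b g h, α (α b g) h = α b (g * h)
  one_act : toConv (α 1) = 1
  mul_act : ∀ a b, toConv (α (a * b)) = toConv (α a) * toConv (α b)
  coact_one : κ 1 = 1
  coact_mul : ∀ a b, κ (a * b) = κ a * κ b
  coact_coassoc : ∀ b, LinearMap.lTensor B comul (κ b) =
    TensorProduct.assoc k B H H (LinearMap.rTensor H κ (κ b))
  coactEval_one : coactEval κ 1 = LinearMap.id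
  yetterDrinfeld : ∀ a h (S : Finset (B × H)), κ a = ∑ j ∈ S, j.1 ⊗ₜ[k] j.2 →
    ∑ i ∈ (ℛ k h).index, LinearMap.lTensor B (LinearMap.mulLeft k ((ℛ k h).left i))
      (κ (α a ((ℛ k h).right i))) =
    ∑ j ∈ S, TensorProduct.map (α j.1) (LinearMap.mulLeft k j.2) (comul h)
  braided : ∀ a b, coactEval κ (toConv (α a)) b = a * b

theorem IsRRCrossed.isBraidedCrossed {α : B →ₗ[k] H →ₗ[k] B} {κ : B →ₗ[k] B ⊗[k] H}
    (hc : IsRRCrossed (fun b h => α b h) (⇑κ)) (hb : IsBraidedComm (fun b h => α b h) (⇑κ)) :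
    IsBraidedCrossed α κ := by
  obtain ⟨-, -, h1, h2, h3, h4, h5, h6, h7, h8, h9⟩ := hc
  refine ⟨h1, h2, ?_, ?_, h5, h6, ?_, ?_, ?_, ?_⟩
  · ext h
    exact h3 h
  · intro a b
    ext h
    exact (h4 a b h).trans (tlift_comul_eq_convMul _ _ h)
  · intro b
    have h := h7 b
    rw [tlift_eq (LinearMap.lTensor B comul) (by simp), tlift_eq
      ((TensorProduct.assoc k B H H).toLinearMap ∘ₗ LinearMap.rTensor H κ) (fun x y => ?_)] at h
    · exact h
    · rw [tlift_eq ((TensorProduct.assoc k B H H).toLinearMap ∘ₗ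
        (TensorProduct.mk k (B ⊗[k] H) H).flip y) (by simp)]
      simp
  · ext b
    have h := h8 b
    rw [tlift_eq (LinearMap.mul' k B ∘ₗ LinearMap.lTensor B
      (Algebra.linearMap k B ∘ₗ counit)) (by simp [Algebra.smul_def, Algebra.commutes])] at h
    exact h
  · intro a h S hS
    have hYD := h9 a h
    rw [tlift_eq (TensorProduct.lift
        ((LinearMap.lTensorHom B ∘ₗ LinearMap.mul k H).compl₂ (κ ∘ₗ α a))) (fun x y => ?_),
      tlift_eq (LinearMap.applyₗ (comul h) ∘ₗ TensorProduct.lift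
        ((TensorProduct.mapBilinear (RingHom.id k) H H B H).compl₁₂ α (LinearMap.mul k H)))
        (fun x y => ?_), hS, map_sum] at hYD
    · refine Eq.trans ?_ hYD
      rw [← (ℛ k h).eq, map_sum]
      rfl
    · rw [tlift_eq (TensorProduct.map (α x) (LinearMap.mulLeft k y)) (by simp)]
      rfl
    · rw [tlift_eq (LinearMap.lTensor B (LinearMap.mulLeft k x)) (by simp)]
      rfl
  · intro a b
    exact ((hb a b).trans congr($(psiFun_eq_coactEval κ (α a)) b)).symm

namespace IsBraidedCrossed

variable {α : B →ₗ[k] H →ₗ[k] B} {κ : B →ₗ[k] B ⊗[k] H}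

theorem leftTranslate_act (hX : IsBraidedCrossed α κ) (b : B) (x : H) :
    leftTranslate (toConv (α b)) x = toConv (α (α b x)) := by
  ext h
  exact (hX.act_act b x h).symm

theorem coactEval_convMul (hX : IsBraidedCrossed α κ) (f g : WithConv (H →ₗ[k] B)) :
    coactEval κ (f * g) = LinearMap.mul' k B ∘ₗ TensorProduct.map (coactEval κ f) g.ofConv ∘ₗ κ := by
  ext b
  have h := congrArg (LinearMap.mul' k B ∘ₗ LinearMap.lTensor B
    (LinearMap.mul' k B ∘ₗ TensorProduct.map f.ofConv g.ofConv)) (hX.coact_coassoc b)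
  have hassoc : (LinearMap.mul' k B ∘ₗ LinearMap.lTensor B
      (LinearMap.mul' k B ∘ₗ TensorProduct.map f.ofConv g.ofConv)) ∘ₗ
      (TensorProduct.assoc k B H H).toLinearMap =
      LinearMap.mul' k B ∘ₗ
        TensorProduct.map (LinearMap.mul' k B ∘ₗ LinearMap.lTensor B f.ofConv) g.ofConv := by
    ext b x y
    simp [mul_assoc]
  have h' := LinearMap.congr_fun hassoc (LinearMap.rTensor H κ (κ b))
  have h'' := h.trans h'
  simp only [LinearMap.comp_apply, ← LinearMap.lTensor_comp_apply, LinearMap.map_rTensor] at h''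
  simpa [coactEval, LinearMap.convMul_def, LinearMap.comp_assoc] using h''

theorem coactEval_convMul_apply (hX : IsBraidedCrossed α κ) {b : B} {S : Finset (B × H)}
    (hS : κ b = ∑ i ∈ S, i.1 ⊗ₜ[k] i.2) (f g : WithConv (H →ₗ[k] B)) :
    coactEval κ (f * g) b = ∑ i ∈ S, coactEval κ f i.1 * g i.2 := by
  simp [hX.coactEval_convMul, hS]

/-- The cocycle condition `ϱ(gh) = (ϱ(g) ◁ h₍₁₎) ϱ(h₍₂₎)` in terms of convolution. -/
def IsCocycle (α : B →ₗ[k] H →ₗ[k] B) (ρ : WithConv (H →ₗ[k] B)) : Prop :=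
  ∀ g, leftTranslate ρ g = toConv (α (ρ g)) * ρ

theorem coactEval_map_one (hX : IsBraidedCrossed α κ) {ρ : WithConv (H →ₗ[k] B)}
    (h1 : ρ 1 = 1) : coactEval κ ρ 1 = 1 := by
  simp [coactEval, hX.coact_one, Algebra.TensorProduct.one_def, h1]

theorem coactEval_map_mul (hX : IsBraidedCrossed α κ) {ρ : WithConv (H →ₗ[k] B)}
    (hρ : IsCocycle α ρ) (a b : B) :
    coactEval κ ρ (a * b) = coactEval κ ρ a * coactEval κ ρ b := by
  obtain ⟨S, hS⟩ := TensorProduct.exists_finset (κ a)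
  obtain ⟨T, hT⟩ := TensorProduct.exists_finset (κ b)
  have h1 (x : B) : ∑ j ∈ T, x * j.1 * ρ j.2 = x * coactEval κ ρ b := by
    simp [coactEval_apply_of_eq_sum hT, Finset.mul_sum, mul_assoc]
  have h2 (i : B × H) : ∑ j ∈ T, j.1 * ρ (i.2 * j.2) = ρ i.2 * coactEval κ ρ b := by
    refine (coactEval_apply_of_eq_sum hT (leftTranslate ρ i.2)).symm.trans ?_
    rw [hρ, hX.coactEval_convMul_apply hT, ← h1]
    simp [hX.braided]
  have h3 : coactEval κ ρ (a * b) = ∑ i ∈ S, ∑ j ∈ T, i.1 * (j.1 * ρ (i.2 * j.2)) := by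
    simp [coactEval, hX.coact_mul, hS, hT, Finset.sum_mul_sum, mul_assoc]
  simp_rw [h3, ← Finset.mul_sum, h2, coactEval_apply_of_eq_sum hS, Finset.sum_mul, mul_assoc]

/-- The algebra endomorphism `b ↦ b₍₀₎ ϱ(b₍₁₎)` attached to a unital cocycle. -/
def psiAlgHom (hX : IsBraidedCrossed α κ) {ρ : WithConv (H →ₗ[k] B)} (hρ : IsCocycle α ρ)
    (h1 : ρ 1 = 1) : B →ₐ[k] B :=
  AlgHom.ofLinearMap (coactEval κ ρ) (hX.coactEval_map_one h1) (hX.coactEval_map_mul hρ)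

@[simp]
theorem psiAlgHom_apply (hX : IsBraidedCrossed α κ) {ρ : WithConv (H →ₗ[k] B)}
    (hρ : IsCocycle α ρ) (h1 : ρ 1 = 1) (b : B) :
    hX.psiAlgHom hρ h1 b = coactEval κ ρ b := rfl

theorem coactEval_convMul_convComp (hX : IsBraidedCrossed α κ) {ρ : WithConv (H →ₗ[k] B)}
    (hρ : IsCocycle α ρ) (h1 : ρ 1 = 1) (f : WithConv (H →ₗ[k] B)) (b : B) :
    coactEval κ (ρ * convComp (hX.psiAlgHom hρ h1) f) b = coactEval κ ρ (coactEval κ f b) := by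
  obtain ⟨S, hS⟩ := TensorProduct.exists_finset (κ b)
  rw [hX.coactEval_convMul_apply hS, coactEval_apply_of_eq_sum hS, map_sum]
  simp [hX.coactEval_map_mul hρ]

/-- The exchange relation `ϱ(h₍₁₎) ψ(b ◁ h₍₂₎) = (ψ(b) ◁ h₍₁₎) ϱ(h₍₂₎)`. -/
theorem convMul_convComp_act (hX : IsBraidedCrossed α κ) {ρ : WithConv (H →ₗ[k] B)}
    (hρ : IsCocycle α ρ) (h1 : ρ 1 = 1) (b : B) :
    ρ * convComp (hX.psiAlgHom hρ h1) (toConv (α b)) = toConv (α (coactEval κ ρ b)) * ρ := by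
  ext h
  obtain ⟨S, hS⟩ := TensorProduct.exists_finset (κ b)
  have key := congrArg (LinearMap.mul' k B ∘ₗ LinearMap.lTensor B ρ.ofConv)
    (hX.yetterDrinfeld b h S hS)
  simp only [map_sum] at key
  have hleft (x : H) (c : B) : ρ x * coactEval κ ρ c = coactEval κ (leftTranslate ρ x) c := by
    obtain ⟨T, hT⟩ := TensorProduct.exists_finset (κ c)
    rw [hρ, hX.coactEval_convMul_apply hT, coactEval_apply_of_eq_sum hT]
    simp [hX.braided, Finset.mul_sum, mul_assoc]
  have hright (j : B × H) : toConv (α (j.1 * ρ j.2)) * ρ =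
      toConv (α j.1) * leftTranslate ρ j.2 := by
    rw [hρ, hX.mul_act, mul_assoc]
  rw [(ℛ k h).convMul_apply, coactEval_apply_of_eq_sum hS, map_sum, toConv_sum, Finset.sum_mul]
  simp only [hright, convComp_apply, psiAlgHom_apply, hleft]
  rw [ofConv_sum, LinearMap.sum_apply]
  refine Eq.trans (Finset.sum_congr rfl fun i _ => ?_)
    (key.trans (Finset.sum_congr rfl fun j _ => ?_))
  · rw [LinearMap.comp_apply, ← LinearMap.lTensor_comp_apply]
    rfl
  · rw [LinearMap.comp_apply, LinearMap.lTensor_map]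
    rfl

theorem isCocycle_one (hX : IsBraidedCrossed α κ) :
    IsCocycle α (1 : WithConv (H →ₗ[k] B)) := by
  intro g
  have h : toConv (α (algebraMap k B (counit g))) = counit (R := k) g • toConv (α 1) := by
    rw [Algebra.algebraMap_eq_smul_one, map_smul, toConv_smul]
  rw [LinearMap.convOne_apply, h, hX.one_act, smul_mul_assoc, mul_one]
  ext h
  simp [Algebra.smul_def]

theorem isCocycle_convMul (hX : IsBraidedCrossed α κ) {ρ σ : WithConv (H →ₗ[k] B)}
    (hρ : IsCocycle α ρ) (h1 : ρ 1 = 1) (hσ : IsCocycle α σ) :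
    IsCocycle α (ρ * convComp (hX.psiAlgHom hρ h1) σ) := by
  intro g
  rw [leftTranslate_convMul]
  simp only [leftTranslate_convComp, hσ _, hρ _, convComp_convMul]
  rw [(ℛ k g).convMul_apply, map_sum, toConv_sum, Finset.sum_mul]
  refine Finset.sum_congr rfl fun i _ => ?_
  rw [hX.mul_act, mul_assoc, ← mul_assoc ρ, hX.convMul_convComp_act]
  simp [mul_assoc]

end IsBraidedCrossed

/-- Right multiplication, as an algebra homomorphism into the opposite endomorphism algebra. -/
def rightMulAlgHom (k B : Type*) [Field k] [Ring B] [Algebra k B] :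
    B →ₐ[k] (Module.End k B)ᵐᵒᵖ :=
  AlgHom.ofLinearMap ((MulOpposite.opLinearEquiv k).toLinearMap ∘ₗ (LinearMap.mul k B).flip)
    (MulOpposite.unop_injective (LinearMap.ext fun x => mul_one x))
    fun a b => MulOpposite.unop_injective (LinearMap.ext fun x => (mul_assoc x a b).symm)

@[simp]
theorem unop_rightMulAlgHom_apply (a x : B) : (rightMulAlgHom k B a).unop x = x * a := rfl

theorem rightMulAlgHom_injective : Function.Injective (rightMulAlgHom k B) := fun a b h => by
  simpa using congr(($h).unop 1)

theorem unop_convMul_apply (F G : WithConv (H →ₗ[k] (Module.End k B)ᵐᵒᵖ)) (h : H) (x : B) :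
    ((F * G) h).unop x =
      ∑ i ∈ (ℛ k h).index, (G ((ℛ k h).right i)).unop ((F ((ℛ k h).left i)).unop x) := by
  rw [(ℛ k h).convMul_apply]
  exact map_sum (LinearMap.applyₗ x ∘ₗ (MulOpposite.opLinearEquiv k).symm.toLinearMap) _ _

namespace IsBraidedCrossed

variable {α : B →ₗ[k] H →ₗ[k] B} {κ : B →ₗ[k] B ⊗[k] H}

/-- The right action as an algebra homomorphism into the opposite endomorphism algebra. -/
def actAlgHom (hX : IsBraidedCrossed α κ) : H →ₐ[k] (Module.End k B)ᵐᵒᵖ :=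
  AlgHom.ofLinearMap ((MulOpposite.opLinearEquiv k).toLinearMap ∘ₗ α.flip)
    (MulOpposite.unop_injective (LinearMap.ext hX.act_one))
    fun g h => MulOpposite.unop_injective (LinearMap.ext fun x => (hX.act_act x g h).symm)

@[simp]
theorem unop_actAlgHom_apply (hX : IsBraidedCrossed α κ) (h : H) (x : B) :
    (hX.actAlgHom h).unop x = α x h := rfl

theorem unop_convMul_rightMul_apply (hX : IsBraidedCrossed α κ) (ρ : WithConv (H →ₗ[k] B)) (h : H)
    (x : B) :
    ((toConv hX.actAlgHom.toLinearMap * convComp (rightMulAlgHom k B) ρ) h).unop x =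
      (toConv (α x) * ρ) h := by
  rw [unop_convMul_apply, (ℛ k h).convMul_apply]
  simp

/-- A cocycle twists the right action of `H` to the action `x ↦ (x ◁ h₍₁₎) ϱ(h₍₂₎)`. -/
noncomputable def twistedAct (hX : IsBraidedCrossed α κ) {ρ : WithConv (H →ₗ[k] B)}
    (hρ : IsCocycle α ρ) (h1 : ρ 1 = 1) : H →ₐ[k] (Module.End k B)ᵐᵒᵖ :=
  AlgHom.ofLinearMap (toConv hX.actAlgHom.toLinearMap * convComp (rightMulAlgHom k B) ρ).ofConv
    (by
      refine MulOpposite.unop_injective (LinearMap.ext fun x => ?_)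
      rw [hX.unop_convMul_rightMul_apply]
      simp [LinearMap.convMul_apply, Bialgebra.comul_one, Algebra.TensorProduct.one_def,
        hX.act_one, h1])
    fun g h => by
      refine MulOpposite.unop_injective (LinearMap.ext fun x => ?_)
      rw [MulOpposite.unop_mul, Module.End.mul_apply]
      simp only [hX.unop_convMul_rightMul_apply]
      suffices leftTranslate (toConv (α x) * ρ) g = toConv (α ((toConv (α x) * ρ) g)) * ρ from
        congr($this h)
      rw [leftTranslate_convMul, (ℛ k g).convMul_apply, map_sum, toConv_sum, Finset.sum_mul]
      refine Finset.sum_congr rfl fun i _ => ?_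
      rw [hX.leftTranslate_act, hρ, hX.mul_act, mul_assoc]

theorem toConv_twistedAct (hX : IsBraidedCrossed α κ) {ρ : WithConv (H →ₗ[k] B)}
    (hρ : IsCocycle α ρ) (h1 : ρ 1 = 1) : toConv (hX.twistedAct hρ h1).toLinearMap =
      toConv hX.actAlgHom.toLinearMap * convComp (rightMulAlgHom k B) ρ := rfl

theorem unop_twistedAct_apply (hX : IsBraidedCrossed α κ) {ρ : WithConv (H →ₗ[k] B)}
    (hρ : IsCocycle α ρ) (h1 : ρ 1 = 1) (h : H) (x : B) :
    (hX.twistedAct hρ h1 h).unop x = (toConv (α x) * ρ) h :=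
  hX.unop_convMul_rightMul_apply ρ h x

/-- The map `h ↦ ϱ(S h₍₁₎) ◁ h₍₂₎`. -/
def convInv (α : B →ₗ[k] H →ₗ[k] B) (ρ : WithConv (H →ₗ[k] B)) : WithConv (H →ₗ[k] B) :=
  toConv (TensorProduct.lift (α ∘ₗ ρ.ofConv ∘ₗ antipode k) ∘ₗ comul)

theorem convInv_apply (ρ : WithConv (H →ₗ[k] B)) (h : H) :
    convInv α ρ h =
      ∑ i ∈ (ℛ k h).index, α (ρ (antipode k ((ℛ k h).left i))) ((ℛ k h).right i) := by
  change TensorProduct.lift _ (comul h) = _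
  nth_rw 1 [← (ℛ k h).eq]
  simp

theorem convInv_one (hX : IsBraidedCrossed α κ) {ρ : WithConv (H →ₗ[k] B)} (h1 : ρ 1 = 1) :
    convInv α ρ 1 = 1 := by
  simp [convInv, Bialgebra.comul_one, Algebra.TensorProduct.one_def, hX.act_one, h1]

/-- The convolution inverse of `h ↦ (· * ϱ(h))`. -/
noncomputable def untwist (hX : IsBraidedCrossed α κ) {ρ : WithConv (H →ₗ[k] B)}
    (hρ : IsCocycle α ρ) (h1 : ρ 1 = 1) : WithConv (H →ₗ[k] (Module.End k B)ᵐᵒᵖ) :=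
  toConv ((hX.twistedAct hρ h1).toLinearMap ∘ₗ antipode k) * toConv hX.actAlgHom.toLinearMap

theorem untwist_mul (hX : IsBraidedCrossed α κ) {ρ : WithConv (H →ₗ[k] B)} (hρ : IsCocycle α ρ)
    (h1 : ρ 1 = 1) : hX.untwist hρ h1 * convComp (rightMulAlgHom k B) ρ = 1 := by
  rw [untwist, mul_assoc, ← hX.toConv_twistedAct hρ h1, algHom_comp_antipode_convMul]

theorem mul_untwist (hX : IsBraidedCrossed α κ) {ρ : WithConv (H →ₗ[k] B)} (hρ : IsCocycle α ρ)
    (h1 : ρ 1 = 1) : convComp (rightMulAlgHom k B) ρ * hX.untwist hρ h1 = 1 := by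
  have h : convComp (rightMulAlgHom k B) ρ = toConv (hX.actAlgHom.toLinearMap ∘ₗ antipode k) *
      toConv (hX.twistedAct hρ h1).toLinearMap := by
    rw [toConv_twistedAct, ← mul_assoc, algHom_comp_antipode_convMul, one_mul]
  rw [h, untwist, mul_assoc, ← mul_assoc (toConv (hX.twistedAct hρ h1).toLinearMap),
    algHom_convMul_comp_antipode, one_mul, algHom_comp_antipode_convMul]

theorem unop_untwist_apply (hX : IsBraidedCrossed α κ) {ρ : WithConv (H →ₗ[k] B)}
    (hρ : IsCocycle α ρ) (h1 : ρ 1 = 1) (h : H) (x : B) :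
    (hX.untwist hρ h1 h).unop x = ∑ i ∈ (ℛ k h).index,
      α ((toConv (α x) * ρ) (antipode k ((ℛ k h).left i))) ((ℛ k h).right i) := by
  rw [untwist, unop_convMul_apply]
  exact Finset.sum_congr rfl fun i _ =>
    congr(α $(hX.unop_twistedAct_apply hρ h1 _ x) ((ℛ k h).right i))

theorem unop_untwist_apply_one (hX : IsBraidedCrossed α κ) {ρ : WithConv (H →ₗ[k] B)}
    (hρ : IsCocycle α ρ) (h1 : ρ 1 = 1) (h : H) :
    (hX.untwist hρ h1 h).unop 1 = convInv α ρ h := by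
  rw [unop_untwist_apply, convInv_apply, hX.one_act, one_mul]

theorem convInv_mul (hX : IsBraidedCrossed α κ) {ρ : WithConv (H →ₗ[k] B)} (hρ : IsCocycle α ρ)
    (h1 : ρ 1 = 1) : convInv α ρ * ρ = 1 := by
  ext h
  have key := congr(($(hX.untwist_mul hρ h1) h).unop 1)
  rw [unop_convMul_apply] at key
  simp only [unop_untwist_apply_one, convComp_apply, unop_rightMulAlgHom_apply] at key
  rw [(ℛ k h).convMul_apply, key]
  simp [Algebra.algebraMap_eq_smul_one]

theorem convComp_convInv (hX : IsBraidedCrossed α κ) {ρ : WithConv (H →ₗ[k] B)}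
    (hρ : IsCocycle α ρ) (h1 : ρ 1 = 1) :
    convComp (rightMulAlgHom k B) (convInv α ρ) = hX.untwist hρ h1 := by
  refine left_inv_eq_right_inv ?_ (hX.mul_untwist hρ h1)
  rw [← convComp_convMul, hX.convInv_mul hρ h1, convComp_one]

theorem mul_convInv (hX : IsBraidedCrossed α κ) {ρ : WithConv (H →ₗ[k] B)} (hρ : IsCocycle α ρ)
    (h1 : ρ 1 = 1) : ρ * convInv α ρ = 1 := by
  refine convComp_injective rightMulAlgHom_injective ?_
  rw [convComp_convMul, hX.convComp_convInv hρ h1, hX.mul_untwist hρ h1, convComp_one]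

theorem leftTranslate_convInv (hX : IsBraidedCrossed α κ) {ρ : WithConv (H →ₗ[k] B)}
    (hρ : IsCocycle α ρ) (h1 : ρ 1 = 1) (g : H) :
    leftTranslate (convInv α ρ) g = convInv α ρ * toConv (α (convInv α ρ g)) := by
  have hW (x : B) : ∑ i ∈ (ℛ k g).index,
      α ((toConv (α x) * ρ) (antipode k ((ℛ k g).left i))) ((ℛ k g).right i) =
      x * convInv α ρ g := by
    rw [← hX.unop_untwist_apply hρ h1, ← hX.convComp_convInv hρ h1]
    rfl
  have hρ' (x y : H) : (toConv (α (ρ x)) * ρ) y = ρ (x * y) := by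
    rw [← hρ, leftTranslate_apply]
  ext h
  rw [convInv, lift_comp_comul_convMul, ← convInv]
  change TensorProduct.lift _ (comul (g * h)) = _
  rw [← ((ℛ k g).mul (ℛ k h)).eq, map_sum, Repr.mul_index, Finset.sum_product_right]
  refine Finset.sum_congr rfl fun j _ => ?_
  rw [LinearMap.comp_apply, LinearMap.comp_apply, ← hX.mul_act, ofConv_toConv, ← hW, map_sum,
    LinearMap.sum_apply]
  refine Finset.sum_congr rfl fun i _ => ?_
  rw [hρ', hX.act_act]
  simp [antipode_mul_antidistrib]

/-- The algebra automorphism `ψ` attached to an invertible cocycle. -/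
noncomputable def psiAlgEquiv (hX : IsBraidedCrossed α κ) {ρ : WithConv (H →ₗ[k] B)}
    (hρ : IsCocycle α ρ) (h1 : ρ 1 = 1) (hψ : Function.Bijective (coactEval κ ρ)) : B ≃ₐ[k] B :=
  AlgEquiv.ofBijective (hX.psiAlgHom hρ h1) hψ

@[simp]
theorem psiAlgEquiv_apply (hX : IsBraidedCrossed α κ) {ρ : WithConv (H →ₗ[k] B)}
    (hρ : IsCocycle α ρ) (h1 : ρ 1 = 1) (hψ : Function.Bijective (coactEval κ ρ)) (b : B) :
    hX.psiAlgEquiv hρ h1 hψ b = coactEval κ ρ b := rfl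

/-- The inverse cocycle `h ↦ ψ⁻¹(ϱ(S h₍₁₎) ◁ h₍₂₎)`. -/
noncomputable def cocycleInv (hX : IsBraidedCrossed α κ) {ρ : WithConv (H →ₗ[k] B)}
    (hρ : IsCocycle α ρ) (h1 : ρ 1 = 1) (hψ : Function.Bijective (coactEval κ ρ)) :
    WithConv (H →ₗ[k] B) :=
  convComp (hX.psiAlgEquiv hρ h1 hψ).symm.toAlgHom (convInv α ρ)

theorem coactEval_cocycleInv_apply (hX : IsBraidedCrossed α κ) {ρ : WithConv (H →ₗ[k] B)}
    (hρ : IsCocycle α ρ) (h1 : ρ 1 = 1) (hψ : Function.Bijective (coactEval κ ρ)) (h : H) :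
    coactEval κ ρ (hX.cocycleInv hρ h1 hψ h) = convInv α ρ h :=
  (hX.psiAlgEquiv hρ h1 hψ).apply_symm_apply _

theorem convComp_cocycleInv (hX : IsBraidedCrossed α κ) {ρ : WithConv (H →ₗ[k] B)}
    (hρ : IsCocycle α ρ) (h1 : ρ 1 = 1) (hψ : Function.Bijective (coactEval κ ρ)) :
    convComp (hX.psiAlgHom hρ h1) (hX.cocycleInv hρ h1 hψ) = convInv α ρ := by
  ext h
  exact hX.coactEval_cocycleInv_apply hρ h1 hψ h

theorem cocycleInv_one (hX : IsBraidedCrossed α κ) {ρ : WithConv (H →ₗ[k] B)}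
    (hρ : IsCocycle α ρ) (h1 : ρ 1 = 1) (hψ : Function.Bijective (coactEval κ ρ)) :
    hX.cocycleInv hρ h1 hψ 1 = 1 := by
  rw [cocycleInv, convComp_apply, hX.convInv_one h1, map_one]

theorem coactEval_cocycleInv (hX : IsBraidedCrossed α κ) {ρ : WithConv (H →ₗ[k] B)}
    (hρ : IsCocycle α ρ) (h1 : ρ 1 = 1) (hψ : Function.Bijective (coactEval κ ρ)) (b : B) :
    coactEval κ (hX.cocycleInv hρ h1 hψ) b = (hX.psiAlgEquiv hρ h1 hψ).symm b := by
  rw [AlgEquiv.eq_symm_apply, psiAlgEquiv_apply, ← hX.coactEval_convMul_convComp hρ h1,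
    convComp_cocycleInv, hX.mul_convInv hρ h1, hX.coactEval_one, LinearMap.id_apply]

theorem isCocycle_cocycleInv (hX : IsBraidedCrossed α κ) {ρ : WithConv (H →ₗ[k] B)}
    (hρ : IsCocycle α ρ) (h1 : ρ 1 = 1) (hψ : Function.Bijective (coactEval κ ρ)) :
    IsCocycle α (hX.cocycleInv hρ h1 hψ) := by
  intro g
  refine convComp_injective (F := hX.psiAlgHom hρ h1) hψ.1 ?_
  rw [← leftTranslate_convComp, convComp_convMul, convComp_cocycleInv,
    hX.leftTranslate_convInv hρ h1, ← hX.coactEval_cocycleInv_apply hρ h1 hψ]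
  have h := hX.convMul_convComp_act hρ h1 (hX.cocycleInv hρ h1 hψ g)
  calc _ = convInv α ρ * (toConv (α (coactEval κ ρ (hX.cocycleInv hρ h1 hψ g))) * ρ) *
        convInv α ρ := by rw [mul_assoc, mul_assoc _ ρ, hX.mul_convInv hρ h1, mul_one]
    _ = _ := by rw [← h, ← mul_assoc, hX.convInv_mul hρ h1, one_mul]

theorem mul_cocycleInv (hX : IsBraidedCrossed α κ) {ρ : WithConv (H →ₗ[k] B)}
    (hρ : IsCocycle α ρ) (h1 : ρ 1 = 1) (hψ : Function.Bijective (coactEval κ ρ)) :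
    ρ * convComp (hX.psiAlgHom hρ h1) (hX.cocycleInv hρ h1 hψ) = 1 := by
  rw [convComp_cocycleInv, hX.mul_convInv hρ h1]

theorem cocycleInv_mul (hX : IsBraidedCrossed α κ) {ρ : WithConv (H →ₗ[k] B)}
    (hρ : IsCocycle α ρ) (h1 : ρ 1 = 1) (hψ : Function.Bijective (coactEval κ ρ)) :
    hX.cocycleInv hρ h1 hψ * convComp (hX.psiAlgEquiv hρ h1 hψ).symm.toAlgHom ρ = 1 := by
  rw [cocycleInv, ← convComp_convMul, hX.convInv_mul hρ h1, convComp_one]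

theorem isZ1cross_iff {ρ : H →ₗ[k] B} :
    IsZ1cross (fun b h => α b h) (⇑κ) ρ ↔
      ρ 1 = 1 ∧ IsCocycle α (toConv ρ) ∧ Function.Bijective (coactEval κ (toConv ρ)) := by
  rw [IsZ1cross, psiFun_eq_coactEval]
  refine and_congr_right fun _ => and_congr_left fun _ => ?_
  simp only [tlift_comul_eq_convMul]
  exact forall_congr' fun g => ⟨fun h => ofConv_injective (LinearMap.ext h), fun h x => congr($h x)⟩

end IsBraidedCrossed

end Coaction

end ConvolutionCocycles

/-- For a braided-commutative right-right `H`-crossed module algebra `B`,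
`Z¹_◁(H,B)` is a group under `(ϱ • ϱ')(h) = ϱ(h₁) ψ(ϱ'(h₂))` with inverse
`ϱ⁻¹(h) = ψ⁻¹(ϱ(Sh₁) ◁ h₂)`; moreover each `ψ` is an algebra automorphism of `B` and `ϱ ↦ ψ`
is a group homomorphism `Z¹_◁(H,B) → Aut(B)`. -/
theorem Z1cross_is_group
    {k : Type u} [Field k] {H : Type v} [Ring H] [HopfAlgebra k H]
    {B : Type v} [Ring B] [Algebra k B]
    (hS : Function.Bijective (HopfAlgebra.antipode (R := k) (A := H)))
    (act : B → H → B) (coact : B → B ⊗[k] H)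
    (hcross : IsRRCrossed act coact) (hbr : IsBraidedComm act coact) :
    (∀ ϱ ϱ' : H →ₗ[k] B, IsZ1cross act coact ϱ → IsZ1cross act coact ϱ' →
      ∃ ϱ'' : H →ₗ[k] B, (∀ h : H, ϱ'' h = bulletFun coact (⇑ϱ) (⇑ϱ') h) ∧
        IsZ1cross act coact ϱ'') ∧
    (∀ ϱ1 ϱ2 ϱ3 : H →ₗ[k] B, IsZ1cross act coact ϱ1 → IsZ1cross act coact ϱ2 →
      IsZ1cross act coact ϱ3 → ∀ h : H,
      bulletFun coact (fun h' => bulletFun coact (⇑ϱ1) (⇑ϱ2) h') (⇑ϱ3) h =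
        bulletFun coact (⇑ϱ1) (fun h' => bulletFun coact (⇑ϱ2) (⇑ϱ3) h') h) ∧
    IsZ1cross act coact (unitBmap (k := k) (H := H) (B := B)) ∧
    (∀ ϱ : H →ₗ[k] B, IsZ1cross act coact ϱ →
      (∀ h : H, bulletFun coact (⇑ϱ) (⇑(unitBmap (k := k) (H := H) (B := B))) h = ϱ h) ∧
      (∀ h : H, bulletFun coact (⇑(unitBmap (k := k) (H := H) (B := B))) (⇑ϱ) h = ϱ h)) ∧
    (∀ ϱ : H →ₗ[k] B, IsZ1cross act coact ϱ → ∃ ϱi : H →ₗ[k] B,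
      (∀ h : H, ϱi h = Function.invFun (psiFun coact (⇑ϱ))
        (tlift k (fun h1 h2 => act (ϱ (HopfAlgebra.antipode (R := k) h1)) h2)
          (Coalgebra.comul (R := k) h))) ∧
      IsZ1cross act coact ϱi ∧
      (∀ h : H, bulletFun coact (⇑ϱ) (⇑ϱi) h = unitBmap (k := k) (H := H) (B := B) h) ∧
      (∀ h : H, bulletFun coact (⇑ϱi) (⇑ϱ) h = unitBmap (k := k) (H := H) (B := B) h)) ∧
    (∀ ϱ : H →ₗ[k] B, IsZ1cross act coact ϱ →
      (∀ a b : B, psiFun coact (⇑ϱ) (a * b) = psiFun coact (⇑ϱ) a * psiFun coact (⇑ϱ) b) ∧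
      psiFun coact (⇑ϱ) 1 = 1 ∧ Function.Bijective (psiFun coact (⇑ϱ))) ∧
    (∀ ϱ ϱ' : H →ₗ[k] B, IsZ1cross act coact ϱ → IsZ1cross act coact ϱ' → ∀ b : B,
      psiFun coact (bulletFun coact (⇑ϱ) (⇑ϱ')) b =
        psiFun coact (⇑ϱ) (psiFun coact (⇑ϱ') b)) := by
  open WithConv in
  obtain ⟨⟨α, hα⟩, ⟨κ, hκ⟩, -⟩ := id hcross
  obtain rfl : (fun b h => α b h) = act := funext fun b => funext (hα b)
  obtain rfl : ⇑κ = coact := funext hκ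
  have hX := hcross.isBraidedCrossed hbr
  simp only [IsBraidedCrossed.isZ1cross_iff]
  refine ⟨?_, ?_, ?_, ?_, ?_, ?_, ?_⟩
  · rintro ρ σ ⟨h1, hρ, hψ⟩ ⟨h1', hσ, hψ'⟩
    refine ⟨(toConv ρ * convComp (hX.psiAlgHom hρ h1) (toConv σ)).ofConv, fun h => ?_, ?_, ?_, ?_⟩
    · rw [bulletFun_eq_convMul]
      rfl
    · simp [LinearMap.convMul_apply, Bialgebra.comul_one, Algebra.TensorProduct.one_def, h1, h1',
        hX.coactEval_map_one]
    · exact hX.isCocycle_convMul hρ h1 hσ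
    · convert hψ.comp hψ'
      ext b
      exact hX.coactEval_convMul_convComp hρ h1 (toConv σ) b
  · rintro ρ₁ ρ₂ ρ₃ ⟨h1, hρ₁, -⟩ ⟨h2, hρ₂, -⟩ - h
    simp only [bulletFun_eq_convMul]
    have h12 : toConv (coactEval κ (toConv ρ₁ * convComp (hX.psiAlgHom hρ₁ h1) (toConv ρ₂)) ∘ₗ ρ₃) =
        convComp (hX.psiAlgHom hρ₁ h1) (convComp (hX.psiAlgHom hρ₂ h2) (toConv ρ₃)) := by
      ext x
      exact hX.coactEval_convMul_convComp hρ₁ h1 (toConv ρ₂) (ρ₃ x)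
    suffices toConv ρ₁ * convComp (hX.psiAlgHom hρ₁ h1) (toConv ρ₂) * toConv
        (coactEval κ (toConv ρ₁ * convComp (hX.psiAlgHom hρ₁ h1) (toConv ρ₂)) ∘ₗ ρ₃) =
        toConv ρ₁ * convComp (hX.psiAlgHom hρ₁ h1)
          (toConv ρ₂ * convComp (hX.psiAlgHom hρ₂ h2) (toConv ρ₃)) from congr($this h)
    rw [h12, convComp_convMul, mul_assoc]
  · refine ⟨by simp [unitBmap], hX.isCocycle_one, ?_⟩
    change Function.Bijective (coactEval κ 1)
    rw [hX.coactEval_one]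
    exact Function.bijective_id
  · rintro ρ ⟨h1, hρ, -⟩
    refine ⟨fun h => ?_, fun h => ?_⟩ <;> rw [bulletFun_eq_convMul]
    · change (toConv ρ * convComp (hX.psiAlgHom hρ h1) 1 : WithConv (H →ₗ[k] B)) h = ρ h
      rw [convComp_one, mul_one]
    · change (1 * toConv (coactEval κ 1 ∘ₗ ρ) : WithConv (H →ₗ[k] B)) h = ρ h
      rw [hX.coactEval_one, one_mul]
      rfl
  · rintro ρ ⟨h1, hρ, hψ⟩
    refine ⟨(hX.cocycleInv hρ h1 hψ).ofConv, fun h => ?_, ⟨hX.cocycleInv_one hρ h1 hψ,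
      hX.isCocycle_cocycleInv hρ h1 hψ, ?_⟩, fun h => ?_, fun h => ?_⟩
    · have hlift : tlift k (fun x y => α (ρ (HopfAlgebra.antipode k x)) y) =
          TensorProduct.lift (α ∘ₗ ρ ∘ₗ HopfAlgebra.antipode k) := tlift_eq _ fun _ _ => rfl
      rw [psiFun_eq_coactEval, hlift]
      exact hψ.1 ((hX.coactEval_cocycleInv_apply hρ h1 hψ h).trans
        (Function.rightInverse_invFun hψ.2 _).symm)
    · convert (hX.psiAlgEquiv hρ h1 hψ).symm.bijective
      ext b
      exact hX.coactEval_cocycleInv hρ h1 hψ b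
    · rw [bulletFun_eq_convMul]
      exact congr($(hX.mul_cocycleInv hρ h1 hψ) h)
    · rw [bulletFun_eq_convMul]
      refine Eq.trans ?_ congr($(hX.cocycleInv_mul hρ h1 hψ) h)
      congr 3
      ext x
      exact hX.coactEval_cocycleInv hρ h1 hψ (ρ x)
  · rintro ρ ⟨h1, hρ, hψ⟩
    rw [psiFun_eq_coactEval]
    exact ⟨hX.coactEval_map_mul hρ, hX.coactEval_map_one h1, hψ⟩
  · rintro ρ σ ⟨h1, hρ, -⟩ - b
    simp only [bulletFun_eq_convMul, psiFun_eq_coactEval]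
    exact hX.coactEval_convMul_convComp hρ h1 (toConv σ) b
end

section
/- Let H be a Hopf algebra with invertible antipode and B a braided-commutative right-right H-crossed module algebra. Then automorphisms of the left bialgebroid B#H^op are in one-to-one correspondence with pairs (φ, ν), where φ: B → B is an algebra automorphism and ν: H → B#H^op, ν(h) = ν(h)⁽¹⁾ # ν(h)⁽²⁾, is an anti-algebra map such that for all a ∈ B, h ∈ H: (1) ν(h₍₁₎) ⊗_B ν(h₍₂₎) = (ν(h)⁽¹⁾ # ν(h)⁽²⁾₍₁₎) ⊗_B (1 # ν(h)⁽²⁾₍₂₎) and ν(h)⁽¹⁾ ε(ν(h)⁽²⁾) = ε(h); (2) s(φ(a₍₀₎)) ν(a₍₁₎) = φ(a)₍₀₎ # φ(a)₍₁₎; (3) ν(h) s(φ(a)) = s(φ(a ◁ h₍₁₎)) ν(h₍₂₎) and ν(h) t(φ(a)) = t(φ(a ◁ h₍₂₎)) ν(h₍₁₎); (4) the map Φ_{(φ,ν)}: B#H^op → B#H^op, Φ_{(φ,ν)}(a#h) := φ(a)·ν(h) (product in B#H^op), is bijective. -/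
open scoped TensorProduct
open TensorProduct

noncomputable section
attribute [local instance] Classical.propDecidable

variable (k : Type*) [Field k]

end

/-! ## Crossed (Drinfeld–Yetter) module algebras and action Hopf algebroids -/

noncomputable section
attribute [local instance] Classical.propDecidable

universe u v

open scoped TensorProduct
open TensorProduct

variable {k : Type u} [Field k] {H : Type v} [Ring H] [HopfAlgebra k H]
  {B : Type v} [Ring B] [Algebra k B]

end

section ActionBialgebroid

universe v

section Bilinear

variable {k : Type*} [CommRing k] {M N Q Q' : Type*} [AddCommGroup M] [Module k M]
  [AddCommGroup N] [Module k N] [AddCommGroup Q] [Module k Q] [AddCommGroup Q'] [Module k Q']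

/-- Bilinearity of an unbundled function of two variables. -/
structure IsBilin (k : Type*) [CommRing k] {M N Q : Type*} [AddCommGroup M] [Module k M]
    [AddCommGroup N] [Module k N] [AddCommGroup Q] [Module k Q] (f : M → N → Q) : Prop where
  add_left : ∀ x x' y, f (x + x') y = f x y + f x' y
  smul_left : ∀ (c : k) x y, f (c • x) y = c • f x y
  add_right : ∀ x y y', f x (y + y') = f x y + f x y'
  smul_right : ∀ (c : k) x y, f x (c • y) = c • f x y

theorem IsBilin.tlift_tmul {f : M → N → Q} (hf : IsBilin k f) (x : M) (y : N) :
    tlift k f (x ⊗ₜ[k] y) = f x y := by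
  have h : ∃ F : M ⊗[k] N →ₗ[k] Q, ∀ x y, F (x ⊗ₜ[k] y) = f x y :=
    ⟨TensorProduct.lift
      (LinearMap.mk₂ k f hf.add_left hf.smul_left hf.add_right hf.smul_right), by simp⟩
  rw [tlift, dif_pos h]
  exact h.choose_spec x y

theorem IsBilin.comp {f : M → N → Q} (hf : IsBilin k f) (g : Q →ₗ[k] Q') :
    IsBilin k (fun x y => g (f x y)) := by
  constructor <;> intros <;>
    simp [hf.add_left, hf.smul_left, hf.add_right, hf.smul_right]

theorem IsBilin.map_tlift {f : M → N → Q} (hf : IsBilin k f) (g : Q →ₗ[k] Q') (z : M ⊗[k] N) :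
    g (tlift k f z) = tlift k (fun x y => g (f x y)) z := by
  refine LinearMap.congr_fun (f := g ∘ₗ tlift k f) (TensorProduct.ext' fun x y => ?_) z
  simp [hf.tlift_tmul, (hf.comp g).tlift_tmul]

theorem tlift_add_fun {f g : M → N → Q} (hf : IsBilin k f) (hg : IsBilin k g) :
    tlift k (fun x y => f x y + g x y) = tlift k f + tlift k g := by
  have h : IsBilin k (fun x y => f x y + g x y) := by
    constructor <;> intros <;>
      simp only [hf.add_left, hf.smul_left, hf.add_right, hf.smul_right,
        hg.add_left, hg.smul_left, hg.add_right, hg.smul_right, smul_add] <;> abel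
  refine TensorProduct.ext' fun x y => ?_
  simp [hf.tlift_tmul, hg.tlift_tmul, h.tlift_tmul]

theorem tlift_smul_fun {f : M → N → Q} (hf : IsBilin k f) (c : k) :
    tlift k (fun x y => c • f x y) = c • tlift k f := by
  refine TensorProduct.ext' fun x y => ?_
  simp [hf.tlift_tmul, (hf.comp (c • LinearMap.id)).tlift_tmul (f := fun x y => c • f x y)]

end Bilinear

variable {k : Type*} [Field k]

namespace BgdST

variable {B L : Type*} [Ring B] [Algebra k B] [Ring L] [Algebra k L] (st : BgdST k B L)

theorem isBilin_mk2 : IsBilin k st.mk2 := by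
  constructor <;> intros <;> simp only [mk2] <;>
    simp only [add_tmul, tmul_add, ← smul_tmul', tmul_smul, Submodule.Quotient.mk_add,
      Submodule.Quotient.mk_smul]

theorem mk2_balanced (a : B) (X Y : L) : st.mk2 (st.t a * X) Y = st.mk2 X (st.s a * Y) :=
  (Submodule.Quotient.eq _).2 (Submodule.subset_span ⟨a, X, Y, rfl⟩)

theorem lift2_mk2 {Q : Type*} [AddCommGroup Q] [Module k Q] {f : L → L → Q}
    (hf : IsBilin k f) (hbal : ∀ a X Y, f (st.t a * X) Y = f X (st.s a * Y)) (X Y : L) :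
    st.lift2 f (st.mk2 X Y) = f X Y := by
  have h : ∃ F : st.T2 →ₗ[k] Q, ∀ x y, F (Submodule.Quotient.mk (x ⊗ₜ[k] y)) = f x y := by
    refine ⟨st.rel.liftQ (tlift k f) (Submodule.span_le.2 ?_), fun x y => ?_⟩
    · rintro _ ⟨a, X, Y, rfl⟩
      simp [hf.tlift_tmul, hbal]
    · exact hf.tlift_tmul x y
  rw [lift2, qtlift, dif_pos h]
  exact h.choose_spec X Y

end BgdST

variable {H : Type v} [Ring H] [HopfAlgebra k H] {B : Type v} [Ring B] [Algebra k B]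
  {L : Type*} [Ring L] [Algebra k L]

theorem isBilin_counit_smul {M : Type*} [AddCommGroup M] [Module k M] :
    IsBilin k (fun (h : H) (m : M) => Coalgebra.counit (R := k) h • m) :=
  ⟨by simp [add_smul], by simp [mul_smul], by simp, fun _ _ _ => smul_comm _ _ _⟩

theorem tlift_counit_smul (h : H) :
    tlift k (fun h1 h2 : H => Coalgebra.counit (R := k) h1 • h2) (Coalgebra.comul (R := k) h) =
      h := by
  have hb := isBilin_counit_smul (k := k) (H := H) (M := H)
  have e : tlift k (fun h1 h2 : H => Coalgebra.counit (R := k) h1 • h2) =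
      (TensorProduct.lid k H).toLinearMap ∘ₗ (Coalgebra.counit (R := k) (A := H)).rTensor H :=
    TensorProduct.ext' fun x y => by simp [hb.tlift_tmul]
  simp [e]

theorem isBilin_smash (act : B →ₗ[k] H →ₗ[k] B) (a b : B) (g : H) : IsBilin k
    (fun h1 h2 : H => (a * act b h1) ⊗ₜ[k] (g * h2)) := by
  constructor <;> intros <;> simp [mul_add, add_tmul, tmul_add, smul_tmul']

theorem isBilin_tlift_smash (act : B →ₗ[k] H →ₗ[k] B) (a : B) (h : H) : IsBilin k (fun b g =>
    tlift k (fun h1 h2 : H => (a * act b h1) ⊗ₜ[k] (g * h2)) (Coalgebra.comul (R := k) h)) := by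
  have hb := isBilin_smash act
  constructor <;> intros <;>
    simp only [map_add, map_smul, LinearMap.add_apply, LinearMap.smul_apply, mul_add, add_mul,
      add_tmul, tmul_add, mul_smul_comm, smul_mul_assoc, ← smul_tmul', tmul_smul,
      tlift_add_fun (hb _ _ _) (hb _ _ _), tlift_smul_fun (hb _ _ _)]

theorem smashMul_tmul_left (act : B →ₗ[k] H →ₗ[k] B) (a : B) (h : H) (w : B ⊗[k] H) :
    smashMul (k := k) (fun b h => act b h) (a ⊗ₜ[k] h) w =
      tlift k (fun b g => tlift k (fun h1 h2 => (a * act b h1) ⊗ₜ[k] (g * h2))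
        (Coalgebra.comul (R := k) h)) w := by
  have h₁ := isBilin_smash act
  have h₂ := isBilin_tlift_smash act
  have h₃ : IsBilin k (fun a h => tlift k (fun b g =>
      tlift k (fun h1 h2 : H => (a * act b h1) ⊗ₜ[k] (g * h2)) (Coalgebra.comul (R := k) h)) w) := by
    constructor <;> intros <;>
      simp only [map_add, map_smul, LinearMap.add_apply, LinearMap.smul_apply, add_mul,
        add_tmul, smul_mul_assoc, ← smul_tmul',
        tlift_add_fun (h₁ _ _ _) (h₁ _ _ _), tlift_smul_fun (h₁ _ _ _),
        tlift_add_fun (h₂ _ _) (h₂ _ _), tlift_smul_fun (h₂ _ _)]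
  rw [smashMul, h₃.tlift_tmul]

theorem smashMul_tmul (act : B →ₗ[k] H →ₗ[k] B) (a b : B) (h g : H) :
    smashMul (k := k) (fun b h => act b h) (a ⊗ₜ[k] h) (b ⊗ₜ[k] g) =
      tlift k (fun h1 h2 => (a * act b h1) ⊗ₜ[k] (g * h2)) (Coalgebra.comul (R := k) h) := by
  rw [smashMul_tmul_left, (isBilin_tlift_smash act _ _).tlift_tmul]

theorem isBilin_tmul_mul (h : H) : IsBilin k (fun (a : B) (g : H) => a ⊗ₜ[k] (h * g)) := by
  constructor <;> intros <;> simp [mul_add, add_tmul, tmul_add, smul_tmul']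

theorem smashMul_one_tmul (act : B →ₗ[k] H →ₗ[k] B)
    (one_act : ∀ h, act 1 h = algebraMap k B (Coalgebra.counit (R := k) h))
    (z : B ⊗[k] H) (h : H) :
    smashMul (k := k) (fun b h => act b h) z (1 ⊗ₜ[k] h) =
      tlift k (fun a g => a ⊗ₜ[k] (h * g)) z := by
  rw [smashMul]
  refine LinearMap.congr_fun (TensorProduct.ext' fun a g => ?_) z
  have hb := isBilin_counit_smul (k := k) (H := H) (M := H)
  have := hb.map_tlift (TensorProduct.mk k B H a ∘ₗ LinearMap.mulLeft k h)
    (Coalgebra.comul (R := k) g)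
  refine (smashMul_tmul act a 1 g h).trans ?_
  rw [tlift_counit_smul] at this
  rw [(isBilin_tmul_mul h).tlift_tmul]
  refine Eq.trans ?_ this.symm
  simp [one_act, ← Algebra.commutes, ← Algebra.smul_def, smul_tmul']

/-- The conditions on a pair `(φ, ν)` describing an automorphism of `B # H^{op}`. -/
def IsAutPair (act : B → H → B) (coact : B → B ⊗[k] H) (st : BgdST k B L)
    (cop : L →ₗ[k] st.T2) (cou : L →ₗ[k] B) (ψ : L ≃ₗ[k] B ⊗[k] H)
    (q : (B →ₐ[k] B) × (H →ₗ[k] L)) : Prop :=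
  Function.Bijective q.1 ∧
  (∀ g h : H, q.2 (g * h) = q.2 h * q.2 g) ∧ q.2 1 = 1 ∧
  (∀ h : H, tlift k (fun h1 h2 => st.mk2 (q.2 h1) (q.2 h2))
    (Coalgebra.comul (R := k) h) = cop (q.2 h)) ∧
  (∀ h : H, cou (q.2 h) = algebraMap k B (Coalgebra.counit (R := k) h)) ∧
  (∀ a : B, tlift k (fun a0 a1 => st.s (q.1 a0) * q.2 a1) (coact a) = st.t (q.1 a)) ∧
  (∀ (a : B) (h : H), q.2 h * st.s (q.1 a) =
    tlift k (fun h1 h2 => st.s (q.1 (act a h1)) * q.2 h2)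
      (Coalgebra.comul (R := k) h)) ∧
  (∀ (a : B) (h : H), q.2 h * st.t (q.1 a) =
    tlift k (fun h1 h2 => st.t (q.1 (act a h2)) * q.2 h1)
      (Coalgebra.comul (R := k) h)) ∧
  Function.Bijective (fun z : L =>
    tlift k (fun a h => st.s (q.1 a) * q.2 h) (ψ z))

/-- The structure of `B # H^{op}` expressed through the source, the target and the
anti-algebra embedding `j : H → B # H^{op}`, `j h = 1 # h`. -/
structure IsActionPresentation (act : B →ₗ[k] H →ₗ[k] B) (coact : B →ₗ[k] B ⊗[k] H)
    (st : BgdST k B L) (cop : L →ₗ[k] st.T2) (cou : L →ₗ[k] B) (ψ : L ≃ₗ[k] B ⊗[k] H)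
    (j : H →ₗ[k] L) : Prop where
  equiv_s_mul : ∀ a h, ψ (st.s a * j h) = a ⊗ₜ[k] h
  j_one : j 1 = 1
  j_mul : ∀ g h, j (g * h) = j h * j g
  mul_s : ∀ a h, j h * st.s a =
    tlift k (fun h1 h2 => st.s (act a h1) * j h2) (Coalgebra.comul (R := k) h)
  mul_t : ∀ a h, j h * st.t a =
    tlift k (fun h1 h2 => st.t (act a h2) * j h1) (Coalgebra.comul (R := k) h)
  equiv_t : ∀ a, ψ (st.t a) = coact a
  cop_j : ∀ h, cop (j h) =
    tlift k (fun h1 h2 => st.mk2 (j h1) (j h2)) (Coalgebra.comul (R := k) h)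
  cou_j : ∀ h, cou (j h) = algebraMap k B (Coalgebra.counit (R := k) h)
  cop_s_mul : ∀ a X, cop (st.s a * X) = st.lift2 (fun x y => st.mk2 (st.s a * x) y) (cop X)
  cou_s_mul : ∀ a X, cou (st.s a * X) = a * cou X

theorem isBilin_mul {M N : Type*} [AddCommGroup M] [Module k M] [AddCommGroup N] [Module k N]
    (f : M →ₗ[k] L) (g : N →ₗ[k] L) : IsBilin k (fun x y => f x * g y) := by
  constructor <;> intros <;> simp [add_mul, mul_add]

theorem isBilin_mul_swap {M N : Type*} [AddCommGroup M] [Module k M] [AddCommGroup N] [Module k N]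
    (f : M →ₗ[k] L) (g : N →ₗ[k] L) : IsBilin k (fun y x => f x * g y) := by
  constructor <;> intros <;> simp [add_mul, mul_add]

theorem isBilin_mk2_comp (st : BgdST k B L) {M N : Type*} [AddCommGroup M] [Module k M]
    [AddCommGroup N] [Module k N] (f : M →ₗ[k] L) (g : N →ₗ[k] L) :
    IsBilin k (fun x y => st.mk2 (f x) (g y)) := by
  have h := st.isBilin_mk2
  constructor <;> intros <;> simp [h.add_left, h.add_right, h.smul_left, h.smul_right]

namespace IsActionPresentation

variable {act : B →ₗ[k] H →ₗ[k] B} {coact : B →ₗ[k] B ⊗[k] H}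
    {st : BgdST k B L} {cop : L →ₗ[k] st.T2} {cou : L →ₗ[k] B} {ψ : L ≃ₗ[k] B ⊗[k] H}
    {j : H →ₗ[k] L}

theorem symm_tmul (hj : IsActionPresentation act coact st cop cou ψ j) (a : B) (h : H) :
    ψ.symm (a ⊗ₜ[k] h) = st.s a * j h := by
  rw [← hj.equiv_s_mul, ψ.symm_apply_apply]

theorem hom_ext (hj : IsActionPresentation act coact st cop cou ψ j)
    {Q : Type*} [AddCommGroup Q] [Module k Q] {F G : L →ₗ[k] Q}
    (h : ∀ a h, F (st.s a * j h) = G (st.s a * j h)) : F = G := by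
  have : F ∘ₗ ψ.symm.toLinearMap = G ∘ₗ ψ.symm.toLinearMap :=
    TensorProduct.ext' fun a x => by simpa [hj.symm_tmul] using h a x
  ext z
  simpa using LinearMap.congr_fun this (ψ z)

/-- `Φ ⊗_B Φ` is evaluated on representatives. -/
theorem _root_.BgdST.lift2_map_mk2 (st : BgdST k B L) (Φ : L →ₐ[k] L) (φ : B → B)
    (hs : ∀ b, Φ (st.s b) = st.s (φ b)) (ht : ∀ b, Φ (st.t b) = st.t (φ b)) (X Y : L) :
    st.lift2 (fun x y => st.mk2 (Φ x) (Φ y)) (st.mk2 X Y) = st.mk2 (Φ X) (Φ Y) :=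
  st.lift2_mk2 (isBilin_mk2_comp st Φ.toLinearMap Φ.toLinearMap)
    (fun a X Y => by simp [hs, ht, st.mk2_balanced]) X Y

theorem tlift_eq_apply (hj : IsActionPresentation act coact st cop cou ψ j)
    {Φ : L →ₐ[k] L} {φ : B →ₐ[k] B} (hs : ∀ b, Φ (st.s b) = st.s (φ b)) (z : L) :
    tlift k (fun a h => st.s (φ a) * Φ (j h)) (ψ z) = Φ z := by
  refine LinearMap.congr_fun (f := tlift k (fun a h => st.s (φ a) * Φ (j h)) ∘ₗ ψ.toLinearMap)
    (g := Φ.toLinearMap) (hj.hom_ext fun a h => ?_) z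
  have hb := isBilin_mul (st.s.toLinearMap ∘ₗ φ.toLinearMap) (Φ.toLinearMap ∘ₗ j)
  simpa [hj.equiv_s_mul, hs] using hb.tlift_tmul a h

theorem isAutPair (hj : IsActionPresentation act coact st cop cou ψ j)
    {Φ : L →ₐ[k] L} {φ : B →ₐ[k] B} (hΦ : st.IsBgdAut cop cou Φ φ) :
    IsAutPair (fun b h => act b h) coact st cop cou ψ (φ, Φ.toLinearMap ∘ₗ j) := by
  have key := hj.tlift_eq_apply hΦ.comp_s
  refine ⟨hΦ.bijB, fun g h => by simp [hj.j_mul], by simp [hj.j_one], fun h => ?_, fun h => ?_,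
    fun a => ?_, fun a h => ?_, fun a h => ?_, ?_⟩
  · simp only [LinearMap.comp_apply, AlgHom.toLinearMap_apply, hΦ.comp_comul, hj.cop_j]
    rw [(isBilin_mk2_comp st j j).map_tlift]
    simp only [st.lift2_map_mk2 Φ φ hΦ.comp_s hΦ.comp_t]
  · simp [hΦ.comp_counit, hj.cou_j]
  · simpa [hj.equiv_t, hΦ.comp_t] using key (st.t a)
  · have hb := isBilin_mul (st.s.toLinearMap ∘ₗ act a) j
    have := hb.map_tlift Φ.toLinearMap (Coalgebra.comul (R := k) h)
    simp only [LinearMap.comp_apply, AlgHom.toLinearMap_apply, ← hj.mul_s, map_mul,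
      hΦ.comp_s] at this
    exact this
  · have hb := isBilin_mul_swap (st.t ∘ₗ act a) j
    have := hb.map_tlift Φ.toLinearMap (Coalgebra.comul (R := k) h)
    simp only [LinearMap.comp_apply, AlgHom.toLinearMap_apply, ← hj.mul_t, map_mul,
      hΦ.comp_t] at this
    exact this
  · convert hΦ.bijL using 1
    exact funext key

theorem exists_isBgdAut (hj : IsActionPresentation act coact st cop cou ψ j)
    {φ : B →ₐ[k] B} {ν : H →ₗ[k] L}
    (hq : IsAutPair (fun b h => act b h) coact st cop cou ψ (φ, ν)) :
    ∃ Φ : L →ₐ[k] L, st.IsBgdAut cop cou Φ φ ∧ ∀ h, Φ (j h) = ν h := by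
  obtain ⟨bij, mul, one, comul, counit, target, source_comm, -, bijΦ⟩ := hq
  dsimp only at bij mul one comul counit target source_comm bijΦ
  let F : L →ₗ[k] L := tlift k (fun a h => st.s (φ a) * ν h) ∘ₗ ψ.toLinearMap
  have F_apply (a : B) (h : H) : F (st.s a * j h) = st.s (φ a) * ν h := by
    have hb := isBilin_mul (st.s.toLinearMap ∘ₗ φ.toLinearMap) ν
    simpa [F, hj.equiv_s_mul] using hb.tlift_tmul a h
  have F_s (a : B) : F (st.s a) = st.s (φ a) := by simpa [hj.j_one, one] using F_apply a 1
  have F_j (h : H) : F (j h) = ν h := by simpa using F_apply 1 h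
  have F_s_mul (a : B) (x : L) : F (st.s a * x) = st.s (φ a) * F x := by
    refine LinearMap.congr_fun (f := F ∘ₗ LinearMap.mulLeft k (st.s a))
      (g := LinearMap.mulLeft k (st.s (φ a)) ∘ₗ F) (hj.hom_ext fun b h => ?_) x
    simp [← mul_assoc, ← map_mul, F_apply]
  have F_mul_j (x : L) (g : H) : F (x * j g) = F x * ν g := by
    refine LinearMap.congr_fun (f := F ∘ₗ LinearMap.mulRight k (j g))
      (g := LinearMap.mulRight k (ν g) ∘ₗ F) (hj.hom_ext fun b h => ?_) x
    simp [mul_assoc, ← hj.j_mul, F_apply, mul]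
  have F_j_mul_s (h : H) (b : B) : F (j h * st.s b) = ν h * st.s (φ b) := by
    have hb := isBilin_mul (st.s.toLinearMap ∘ₗ act b) j
    have := hb.map_tlift F (Coalgebra.comul (R := k) h)
    simp only [LinearMap.comp_apply, AlgHom.toLinearMap_apply, ← hj.mul_s, F_apply,
      ← source_comm] at this
    exact this
  have F_mul (x y : L) : F (x * y) = F x * F y := by
    refine LinearMap.congr_fun (f := F ∘ₗ LinearMap.mulLeft k x)
      (g := LinearMap.mulLeft k (F x) ∘ₗ F) (hj.hom_ext fun b g => ?_) y
    refine LinearMap.congr_fun (f := F ∘ₗ LinearMap.mulRight k (st.s b * j g))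
      (g := LinearMap.mulRight k (F (st.s b * j g)) ∘ₗ F) (hj.hom_ext fun a h => ?_) x
    have e : st.s a * j h * (st.s b * j g) = st.s a * (j h * st.s b * j g) := by
      simp only [mul_assoc]
    simp only [LinearMap.comp_apply, LinearMap.mulRight_apply, e, F_s_mul, F_mul_j, F_j_mul_s,
      F_j]
    simp only [mul_assoc]
  let Φ : L →ₐ[k] L := AlgHom.ofLinearMap F (by simpa using F_s 1) F_mul
  have Φ_s (a : B) : Φ (st.s a) = st.s (φ a) := F_s a
  have Φ_t (a : B) : Φ (st.t a) = st.t (φ a) := by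
    rw [← target, ← hj.equiv_t]; rfl
  refine ⟨Φ, ⟨bijΦ, bij, Φ_s, Φ_t, fun X => ?_, fun X => ?_⟩, F_j⟩
  · refine LinearMap.congr_fun (f := cop ∘ₗ Φ.toLinearMap)
      (g := st.lift2 (fun x y => st.mk2 (Φ x) (Φ y)) ∘ₗ cop) (hj.hom_ext fun a h => ?_) X
    have lift_s (b : B) (X Y : L) : st.lift2 (fun x y => st.mk2 (st.s b * x) y) (st.mk2 X Y) =
        st.mk2 (st.s b * X) Y :=
      st.lift2_mk2 (isBilin_mk2_comp st (LinearMap.mulLeft k (st.s b)) LinearMap.id)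
        (fun a X Y => by
          simp only [LinearMap.mulLeft_apply, LinearMap.id_apply]
          rw [← mul_assoc, st.st_comm, mul_assoc, st.mk2_balanced]) X Y
    have hb := isBilin_mk2_comp st (LinearMap.mulLeft k (st.s a) ∘ₗ j) j
    simp only [LinearMap.comp_apply, AlgHom.toLinearMap_apply, map_mul, Φ_s,
      show Φ (j h) = ν h from F_j h, hj.cop_s_mul, ← comul, hj.cop_j]
    rw [(isBilin_mk2_comp st ν ν).map_tlift, (isBilin_mk2_comp st j j).map_tlift]
    simp only [lift_s]
    refine Eq.trans ?_ (hb.map_tlift _ _).symm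
    simp only [LinearMap.comp_apply, LinearMap.mulLeft_apply, st.lift2_map_mk2 Φ φ Φ_s Φ_t,
      map_mul, Φ_s, show ∀ h, Φ (j h) = ν h from F_j]
  · refine LinearMap.congr_fun (f := cou ∘ₗ Φ.toLinearMap)
      (g := φ.toLinearMap ∘ₗ cou) (hj.hom_ext fun a h => ?_) X
    simp [Φ_s, show Φ (j h) = ν h from F_j h, hj.cou_s_mul, counit, hj.cou_j]

end IsActionPresentation

theorem isActionPresentation
    (act : B →ₗ[k] H →ₗ[k] B) (coact : B →ₗ[k] B ⊗[k] H)
    (hcross : IsRRCrossed (fun b h => act b h) (fun b => coact b))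
    (ψ : L ≃ₗ[k] B ⊗[k] H)
    (hψ1 : ψ 1 = 1) (hψm : ∀ x y : L, ψ (x * y) = smashMul (fun b h => act b h) (ψ x) (ψ y))
    (st : BgdST k B L) (cop : L →ₗ[k] st.T2) (cou : L →ₗ[k] B)
    (hbgd : st.IsLeftBialgebroid cop cou)
    (hsψ : ∀ b : B, st.s b = ψ.symm (b ⊗ₜ[k] (1 : H)))
    (htψ : ∀ b : B, st.t b = ψ.symm (coact b))
    (hcouψ : ∀ z : L, cou z =
      tlift k (fun a h => (Coalgebra.counit (R := k) h : k) • a) (ψ z))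
    (hcopψ : ∀ z : L, cop z =
      tlift k (fun a h => tlift k (fun h1 h2 => st.mk2 (ψ.symm (a ⊗ₜ[k] h1))
        (ψ.symm ((1 : B) ⊗ₜ[k] h2))) (Coalgebra.comul (R := k) h)) (ψ z)) :
    IsActionPresentation act coact st cop cou ψ
      (ψ.symm.toLinearMap ∘ₗ TensorProduct.mk k B H 1) := by
  obtain ⟨-, -, -, -, one_act, -, -, -, -, -, yd⟩ := hcross
  dsimp only at one_act yd
  have ψs (b : B) : ψ (st.s b) = b ⊗ₜ[k] (1 : H) := by simp [hsψ]
  have mul_j (z : L) (h : H) : ψ (z * ψ.symm (1 ⊗ₜ[k] h)) =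
      tlift k (fun a g => a ⊗ₜ[k] (h * g)) (ψ z) := by
    rw [hψm, ψ.apply_symm_apply, smashMul_one_tmul act one_act]
  have s_mul_j (a : B) (h : H) : ψ (st.s a * ψ.symm (1 ⊗ₜ[k] h)) = a ⊗ₜ[k] h := by
    rw [mul_j, ψs, (isBilin_tmul_mul h).tlift_tmul, mul_one]
  refine ⟨s_mul_j, ?_, fun g h => ?_, fun a h => ψ.injective ?_, fun a h => ψ.injective ?_,
    fun a => ?_, fun h => ?_, fun h => ?_, hbgd.comul_s, hbgd.counit_s⟩ <;>
    try dsimp only [LinearMap.comp_apply, TensorProduct.mk_apply, LinearEquiv.coe_coe]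
  · rw [ψ.symm_apply_eq, hψ1, Algebra.TensorProduct.one_def]
  · rw [ψ.symm_apply_eq, mul_j, ψ.apply_symm_apply, (isBilin_tmul_mul g).tlift_tmul]
  · rw [hψm, ψs, ψ.apply_symm_apply, smashMul_tmul]
    refine Eq.trans ?_ ((isBilin_mul (st.s.toLinearMap ∘ₗ act a)
      (ψ.symm.toLinearMap ∘ₗ TensorProduct.mk k B H 1)).map_tlift ψ.toLinearMap _).symm
    simp [s_mul_j]
  · rw [hψm, ψ.apply_symm_apply, smashMul_tmul_left, htψ, ψ.apply_symm_apply]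
    refine Eq.trans ?_ ((isBilin_mul_swap (st.t ∘ₗ act a)
      (ψ.symm.toLinearMap ∘ₗ TensorProduct.mk k B H 1)).map_tlift ψ.toLinearMap _).symm
    simp only [one_mul, ← yd, LinearMap.comp_apply, TensorProduct.mk_apply, LinearEquiv.coe_coe,
      mul_j, htψ, ψ.apply_symm_apply]
  · rw [htψ, ψ.apply_symm_apply]
  · have h₁ (a : B) : IsBilin k (fun h1 h2 : H => st.mk2 (ψ.symm (a ⊗ₜ[k] h1))
        (ψ.symm ((1 : B) ⊗ₜ[k] h2))) :=
      isBilin_mk2_comp st (ψ.symm.toLinearMap ∘ₗ TensorProduct.mk k B H a)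
        (ψ.symm.toLinearMap ∘ₗ TensorProduct.mk k B H 1)
    have h₂ : IsBilin k (fun a h => tlift k (fun h1 h2 => st.mk2 (ψ.symm (a ⊗ₜ[k] h1))
        (ψ.symm ((1 : B) ⊗ₜ[k] h2))) (Coalgebra.comul (R := k) h)) := by
      constructor <;> intros <;>
        simp only [map_add, map_smul, LinearMap.add_apply, LinearMap.smul_apply, add_tmul,
          ← smul_tmul', st.isBilin_mk2.add_left, st.isBilin_mk2.smul_left,
          tlift_add_fun (h₁ _) (h₁ _), tlift_smul_fun (h₁ _)]
    rw [hcopψ, ψ.apply_symm_apply, h₂.tlift_tmul]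
  · have hb : IsBilin k (fun (a : B) (h : H) => Coalgebra.counit (R := k) h • a) := by
      have hc := isBilin_counit_smul (k := k) (H := H) (M := B)
      exact ⟨fun _ _ _ => hc.add_right _ _ _, fun _ _ _ => hc.smul_right _ _ _,
        fun _ _ _ => hc.add_left _ _ _, fun _ _ _ => hc.smul_left _ _ _⟩
    rw [hcouψ, ψ.apply_symm_apply, hb.tlift_tmul, Algebra.algebraMap_eq_smul_one]

end ActionBialgebroid

/-- Automorphisms of the action bialgebroid `B # H^{op}` are in one-to-one
correspondence with pairs `(φ, ν)` of an algebra automorphism `φ` of `B` and an anti-algebra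
map `ν : H → B # H^{op}` satisfying conditions (1)–(4). -/
theorem action_bialgebroid_automorphisms
    {k : Type u} [Field k] {H : Type v} [Ring H] [HopfAlgebra k H]
    {B : Type v} [Ring B] [Algebra k B]
    (hS : Function.Bijective (HopfAlgebra.antipode (R := k) (A := H)))
    (act : B → H → B) (coact : B → B ⊗[k] H)
    (hcross : IsRRCrossed act coact) (hbr : IsBraidedComm act coact)
    {L0 : Type v} [Ring L0] [Algebra k L0] (ψ : L0 ≃ₗ[k] B ⊗[k] H)
    (hψ1 : ψ 1 = 1) (hψm : ∀ x y : L0, ψ (x * y) = smashMul act (ψ x) (ψ y))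
    (st : BgdST k B L0) (cop : L0 →ₗ[k] st.T2) (cou : L0 →ₗ[k] B)
    (hbgd : st.IsLeftBialgebroid cop cou)
    (hsψ : ∀ b : B, st.s b = ψ.symm (b ⊗ₜ[k] (1 : H)))
    (htψ : ∀ b : B, st.t b = ψ.symm (coact b))
    (hcouψ : ∀ z : L0, cou z =
      tlift k (fun a h => (Coalgebra.counit (R := k) h : k) • a) (ψ z))
    (hcopψ : ∀ z : L0, cop z =
      tlift k (fun a h => tlift k (fun h1 h2 => st.mk2 (ψ.symm (a ⊗ₜ[k] h1))
        (ψ.symm ((1 : B) ⊗ₜ[k] h2))) (Coalgebra.comul (R := k) h)) (ψ z)) :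
    ∃ e : {A : (L0 →ₐ[k] L0) × (B →ₐ[k] B) // st.IsBgdAut cop cou A.1 A.2} ≃
        {q : (B →ₐ[k] B) × (H →ₗ[k] L0) //
          Function.Bijective q.1 ∧
          (∀ g h : H, q.2 (g * h) = q.2 h * q.2 g) ∧ q.2 1 = 1 ∧
          (∀ h : H, tlift k (fun h1 h2 => st.mk2 (q.2 h1) (q.2 h2))
            (Coalgebra.comul (R := k) h) = cop (q.2 h)) ∧
          (∀ h : H, cou (q.2 h) = algebraMap k B (Coalgebra.counit (R := k) h)) ∧
          (∀ a : B, tlift k (fun a0 a1 => st.s (q.1 a0) * q.2 a1) (coact a) = st.t (q.1 a)) ∧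
          (∀ (a : B) (h : H), q.2 h * st.s (q.1 a) =
            tlift k (fun h1 h2 => st.s (q.1 (act a h1)) * q.2 h2)
              (Coalgebra.comul (R := k) h)) ∧
          (∀ (a : B) (h : H), q.2 h * st.t (q.1 a) =
            tlift k (fun h1 h2 => st.t (q.1 (act a h2)) * q.2 h1)
              (Coalgebra.comul (R := k) h)) ∧
          Function.Bijective (fun z : L0 =>
            tlift k (fun a h => st.s (q.1 a) * q.2 h) (ψ z))},
      ∀ A : {A : (L0 →ₐ[k] L0) × (B →ₐ[k] B) // st.IsBgdAut cop cou A.1 A.2},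
        ((e A).1.1 : B →ₐ[k] B) = A.1.2 ∧
        ∀ z : L0, A.1.1 z = tlift k (fun a h => st.s ((e A).1.1 a) * (e A).1.2 h) (ψ z) := by
  obtain ⟨⟨act', hact⟩, ⟨coact', hcoact⟩, -⟩ := id hcross
  obtain rfl : (fun b h => act' b h) = act := funext₂ hact
  obtain rfl : (fun b => coact' b) = coact := funext hcoact
  have hj := isActionPresentation act' coact' hcross ψ hψ1 hψm st cop cou hbgd hsψ htψ
    hcouψ hcopψ
  set j := ψ.symm.toLinearMap ∘ₗ TensorProduct.mk k B H 1
  refine ⟨Equiv.ofBijective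
    (fun A => ⟨(A.1.2, A.1.1.toLinearMap ∘ₗ j), hj.isAutPair A.2⟩) ⟨?_, ?_⟩,
    fun A => ⟨rfl, fun z => (hj.tlift_eq_apply A.2.comp_s z).symm⟩⟩
  · rintro ⟨⟨Φ, φ⟩, hΦ⟩ ⟨⟨Φ', φ'⟩, hΦ'⟩ h
    obtain ⟨hφ, h⟩ := Prod.ext_iff.1 (Subtype.ext_iff.1 h)
    obtain rfl : φ = φ' := hφ
    obtain rfl : Φ = Φ' := by
      refine AlgHom.toLinearMap_injective (hj.hom_ext fun a x => ?_)
      have := LinearMap.congr_fun h x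
      simp only [LinearMap.comp_apply, AlgHom.toLinearMap_apply] at this
      simp [hΦ.comp_s, hΦ'.comp_s, this]
    rfl
  · rintro ⟨⟨φ, ν⟩, hq⟩
    obtain ⟨Φ, hΦ, hν⟩ := hj.exists_isBgdAut hq
    exact ⟨⟨(Φ, φ), hΦ⟩, Subtype.ext (Prod.ext rfl (LinearMap.ext hν))⟩
end
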